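/- Let k₁, k₂ ≥ 0 be constants with k₂² < 2k₁, set μ₁ = √(√(2k₁) + k₂) and μ₂ = √(√(2k₁) − k₂), and define s₀(t) = μ₂²·sinh²(μ₁t/√2) − μ₁²·sin²(μ₂t/√2), s₁(t) = 2√k₁·μ₁μ₂(μ₁·sin(μ₂t/√2)·cos(μ₂t/√2) + μ₂·cosh(μ₁t/√2)·sinh(μ₁t/√2)), s₂(t) = √(2k₁)·(μ₁²·sin²(μ₂t/√2) + μ₂²·sinh²(μ₁t/√2)). Assume ∇²h ≥ [[−k₁ I, 0],[0, −k₂ I]] (in n×n block form) everywhere. Then for every t ∈ (0,T) with s₀(t) > 0 and every (x,v) ∈ ℝⁿ×ℝⁿ, the 2n×2n symmetric matrix inequality ∇² log ρ(t,x,v) − ½∇²U(x,v) ≥ ½·[[−(s₁(t)/s₀(t)) I, (s₂(t)/s₀(t)) I],[(s₂(t)/s₀(t)) I, −(s₀'(t)/s₀(t)) I]] holds. -/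

import Mathlib

noncomputable section
open Real Set Matrix

/-- `ℝⁿ` with the Euclidean norm. -/
abbrev E (n : ℕ) := EuclideanSpace ℝ (Fin n)

/-- The standard basis of `ℝⁿ × ℝⁿ`, indexed by `Fin n ⊕ Fin n`: `Sum.inl i` is the `i`-th
`x`-direction and `Sum.inr i` is the `i`-th `v`-direction. -/
def stdBasis (n : ℕ) : Fin n ⊕ Fin n → E n × E n
  | Sum.inl i => (EuclideanSpace.single i 1, 0)
  | Sum.inr i => (0, EuclideanSpace.single i 1)

/-- Partial derivative of `φ : ℝⁿ × ℝⁿ → ℝ` in the `j`-th coordinate direction. -/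
def pd {n : ℕ} (φ : E n × E n → ℝ) (j : Fin n ⊕ Fin n) (p : E n × E n) : ℝ :=
  fderiv ℝ φ p (stdBasis n j)

/-- The full Hessian of `φ` in the variables `(x, v)`, as a `2n × 2n` matrix. -/
def Hess {n : ℕ} (φ : E n × E n → ℝ) (p : E n × E n) :
    Matrix (Fin n ⊕ Fin n) (Fin n ⊕ Fin n) ℝ :=
  Matrix.of fun i j => pd (pd φ j) i p

/-- The Laplacian in the `v`-variables: `Δ_v φ = Σᵢ ∂²φ/∂vᵢ²`. -/
def lapV {n : ℕ} (φ : E n × E n → ℝ) (p : E n × E n) : ℝ :=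
  ∑ i : Fin n, pd (pd φ (Sum.inr i)) (Sum.inr i) p

/-- The squared Euclidean norm of the full gradient `∇φ`. -/
def gradNormSq {n : ℕ} (φ : E n × E n → ℝ) (p : E n × E n) : ℝ :=
  ∑ j : Fin n ⊕ Fin n, (pd φ j p) ^ 2

/-- The function `h = -½⟨v, ∇ₓU⟩ + ½Δ_v U - ¼|∇_v U|²`. -/
def hfun {n : ℕ} (U : E n × E n → ℝ) (p : E n × E n) : ℝ :=
  -(1/2) * (∑ i : Fin n, p.2 i * pd U (Sum.inl i) p) + (1/2) * lapV U p
    - (1/4) * ∑ i : Fin n, (pd U (Sum.inr i) p) ^ 2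

/-- The block-diagonal matrix `[[a·I, 0], [0, b·I]]`. -/
def blockDiag (n : ℕ) (a b : ℝ) : Matrix (Fin n ⊕ Fin n) (Fin n ⊕ Fin n) ℝ :=
  Matrix.fromBlocks (a • 1) 0 0 (b • 1)

/-- The right-hand side `½·[[-(s₁/s₀)I, (s₂/s₀)I], [(s₂/s₀)I, -(s₀'/s₀)I]]` of the
matrix differential Harnack inequality. -/
def harnackMatrix (n : ℕ) (s₀ s₁ s₂ : ℝ → ℝ) (t : ℝ) :
    Matrix (Fin n ⊕ Fin n) (Fin n ⊕ Fin n) ℝ :=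
  (1/2 : ℝ) • Matrix.fromBlocks (-(s₁ t / s₀ t) • 1) ((s₂ t / s₀ t) • 1)
    ((s₂ t / s₀ t) • 1) (-(deriv s₀ t / s₀ t) • 1)

/-- `μ₁ = √(√(2k₁) + k₂)`. -/
def mu1 (k₁ k₂ : ℝ) : ℝ := Real.sqrt (Real.sqrt (2 * k₁) + k₂)

/-- `μ₂ = √(√(2k₁) − k₂)`. -/
def mu2 (k₁ k₂ : ℝ) : ℝ := Real.sqrt (Real.sqrt (2 * k₁) - k₂)

/-- `s₀` in the case `k₂² < 2k₁`. -/
def s0C (k₁ k₂ t : ℝ) : ℝ :=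
  (mu2 k₁ k₂) ^ 2 * Real.sinh (mu1 k₁ k₂ / Real.sqrt 2 * t) ^ 2
    - (mu1 k₁ k₂) ^ 2 * Real.sin (mu2 k₁ k₂ / Real.sqrt 2 * t) ^ 2

/-- `s₁` in the case `k₂² < 2k₁`. -/
def s1C (k₁ k₂ t : ℝ) : ℝ :=
  2 * Real.sqrt k₁ * mu1 k₁ k₂ * mu2 k₁ k₂ *
    (mu1 k₁ k₂ * Real.sin (mu2 k₁ k₂ / Real.sqrt 2 * t) * Real.cos (mu2 k₁ k₂ / Real.sqrt 2 * t)
      + mu2 k₁ k₂ * Real.cosh (mu1 k₁ k₂ / Real.sqrt 2 * t) *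
          Real.sinh (mu1 k₁ k₂ / Real.sqrt 2 * t))

/-- `s₂` in the case `k₂² < 2k₁`. -/
def s2C (k₁ k₂ t : ℝ) : ℝ :=
  Real.sqrt (2 * k₁) *
    ((mu1 k₁ k₂) ^ 2 * Real.sin (mu2 k₁ k₂ / Real.sqrt 2 * t) ^ 2
      + (mu2 k₁ k₂) ^ 2 * Real.sinh (mu1 k₁ k₂ / Real.sqrt 2 * t) ^ 2)

open scoped ContDiff

section Calculus

variable {n : ℕ}

/-- The squared Euclidean norm on `ℝⁿ × ℝⁿ`. -/
def nsq (p : E n × E n) : ℝ := ‖p.1‖ ^ 2 + ‖p.2‖ ^ 2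

/-- The coordinates of a point of `ℝⁿ × ℝⁿ` in the basis `stdBasis n`. -/
def coords (z : E n × E n) : Fin n ⊕ Fin n → ℝ := Sum.elim z.1 z.2

/-- The nonlinear operator `φ ↦ Δ_v φ + |∇_v φ|² - ⟨v, ∇ₓ φ⟩`. -/
def kin (φ : E n × E n → ℝ) (p : E n × E n) : ℝ :=
  lapV φ p + (∑ i : Fin n, pd φ (Sum.inr i) p ^ 2) - ∑ i : Fin n, p.2 i * pd φ (Sum.inl i) p

lemma nsq_nonneg (p : E n × E n) : 0 ≤ nsq p := by unfold nsq; positivity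

lemma continuous_nsq : Continuous (nsq (n := n)) := by unfold nsq; fun_prop

lemma nsq_neg (p : E n × E n) : nsq (-p) = nsq p := by simp [nsq]

lemma nsq_smul (c : ℝ) (p : E n × E n) : nsq (c • p) = c ^ 2 * nsq p := by
  simp only [nsq, Prod.smul_fst, Prod.smul_snd, norm_smul, mul_pow, Real.norm_eq_abs, sq_abs]
  ring

lemma nsq_add_le (p q : E n × E n) : nsq (p + q) ≤ 2 * nsq p + 2 * nsq q := by
  have h1 := parallelogram_law_with_norm ℝ p.1 q.1
  have h2 := parallelogram_law_with_norm ℝ p.2 q.2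
  simp only [nsq, Prod.fst_add, Prod.snd_add]
  nlinarith [mul_self_nonneg ‖p.1 - q.1‖, mul_self_nonneg ‖p.2 - q.2‖]

lemma norm_sq_le_nsq (p : E n × E n) : ‖p‖ ^ 2 ≤ nsq p := by
  rw [Prod.norm_def]
  rcases max_cases ‖p.1‖ ‖p.2‖ with h | h <;> rw [h.1] <;> unfold nsq <;>
    nlinarith [sq_nonneg ‖p.1‖, sq_nonneg ‖p.2‖]

lemma isCompact_nsq_le (r : ℝ) : IsCompact {p : E n × E n | nsq p ≤ r} := by
  refine Metric.isCompact_of_isClosed_isBounded (isClosed_le continuous_nsq continuous_const) ?_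
  refine (Metric.isBounded_closedBall (x := (0 : E n × E n)) (r := √r)).subset fun p hp => ?_
  rw [mem_closedBall_zero_iff]
  exact Real.le_sqrt_of_sq_le ((norm_sq_le_nsq p).trans hp)

lemma sum_coords_smul (z : E n × E n) : ∑ j, coords z j • _root_.stdBasis n j = z := by
  rw [Fintype.sum_sum_type]
  refine Prod.ext ?_ ?_
  · ext k
    simp [coords, _root_.stdBasis, Prod.fst_sum, Pi.single_apply]
  · ext k
    simp [coords, _root_.stdBasis, Prod.snd_sum, Pi.single_apply]

lemma fderiv_apply_eq_sum (φ : E n × E n → ℝ) (p z : E n × E n) :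
    fderiv ℝ φ p z = ∑ j, coords z j * pd φ j p := by
  conv_lhs => rw [← sum_coords_smul z]
  simp [pd]

lemma sum_coords_sq (z : E n × E n) : ∑ j, coords z j ^ 2 = nsq z := by
  simp [Fintype.sum_sum_type, coords, nsq, EuclideanSpace.norm_sq_eq]

lemma contDiff_pd {φ : E n × E n → ℝ} (hφ : ContDiff ℝ ∞ φ) (j : Fin n ⊕ Fin n) :
    ContDiff ℝ ∞ (pd φ j) := by
  unfold pd
  exact (hφ.fderiv_right (m := ∞) (by simp)).clm_apply contDiff_const

lemma ContDiff.diff {φ : E n × E n → ℝ} (hφ : ContDiff ℝ ∞ φ) : Differentiable ℝ φ :=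
  hφ.differentiable (by simp)

lemma contDiff_lapV {φ : E n × E n → ℝ} (hφ : ContDiff ℝ ∞ φ) : ContDiff ℝ ∞ (lapV φ) := by
  unfold lapV
  exact ContDiff.sum fun i _ => contDiff_pd (contDiff_pd hφ _) _

lemma pd_add {φ ψ : E n × E n → ℝ} (hφ : Differentiable ℝ φ) (hψ : Differentiable ℝ ψ)
    (j : Fin n ⊕ Fin n) : pd (fun p => φ p + ψ p) j = fun p => pd φ j p + pd ψ j p := by
  ext p; simp [pd, fderiv_fun_add (hφ p) (hψ p)]

lemma pd_sub {φ ψ : E n × E n → ℝ} (hφ : Differentiable ℝ φ) (hψ : Differentiable ℝ ψ)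
    (j : Fin n ⊕ Fin n) : pd (fun p => φ p - ψ p) j = fun p => pd φ j p - pd ψ j p := by
  ext p; simp [pd, fderiv_fun_sub (hφ p) (hψ p)]

lemma pd_const_mul {φ : E n × E n → ℝ} (hφ : Differentiable ℝ φ) (c : ℝ)
    (j : Fin n ⊕ Fin n) : pd (fun p => c * φ p) j = fun p => c * pd φ j p := by
  ext p; simp [pd, fderiv_const_mul (hφ p) c]

lemma pd_const (c : ℝ) (j : Fin n ⊕ Fin n) : pd (fun _ : E n × E n => c) j = fun _ => 0 := by
  ext p; simp [pd]

lemma pd_mul {φ ψ : E n × E n → ℝ} (hφ : Differentiable ℝ φ) (hψ : Differentiable ℝ ψ)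
    (j : Fin n ⊕ Fin n) :
    pd (fun p => φ p * ψ p) j = fun p => φ p * pd ψ j p + ψ p * pd φ j p := by
  ext p; simp [pd, fderiv_fun_mul (hφ p) (hψ p)]

lemma pd_exp {φ : E n × E n → ℝ} (hφ : Differentiable ℝ φ) (j : Fin n ⊕ Fin n) :
    pd (fun p => Real.exp (φ p)) j = fun p => Real.exp (φ p) * pd φ j p := by
  ext p; simp [pd, fderiv_exp (hφ p)]

lemma pd_comp_add {φ : E n × E n → ℝ} (z : E n × E n) (j : Fin n ⊕ Fin n) :
    pd (fun p => φ (p + z)) j = fun p => pd φ j (p + z) := by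
  ext p; simp [pd, fderiv_comp_add_right]

lemma lapV_add {φ ψ : E n × E n → ℝ} (hφ : ContDiff ℝ ∞ φ) (hψ : ContDiff ℝ ∞ ψ)
    (p : E n × E n) : lapV (fun p => φ p + ψ p) p = lapV φ p + lapV ψ p := by
  simp only [lapV, pd_add hφ.diff hψ.diff, pd_add (contDiff_pd hφ _).diff (contDiff_pd hψ _).diff,
    Finset.sum_add_distrib]

lemma lapV_sub {φ ψ : E n × E n → ℝ} (hφ : ContDiff ℝ ∞ φ) (hψ : ContDiff ℝ ∞ ψ)
    (p : E n × E n) : lapV (fun p => φ p - ψ p) p = lapV φ p - lapV ψ p := by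
  simp only [lapV, pd_sub hφ.diff hψ.diff, pd_sub (contDiff_pd hφ _).diff (contDiff_pd hψ _).diff,
    Finset.sum_sub_distrib]

lemma lapV_const_mul {φ : E n × E n → ℝ} (hφ : ContDiff ℝ ∞ φ) (c : ℝ)
    (p : E n × E n) : lapV (fun p => c * φ p) p = c * lapV φ p := by
  simp only [lapV, pd_const_mul hφ.diff, pd_const_mul (contDiff_pd hφ _).diff, Finset.mul_sum]

lemma lapV_const (c : ℝ) (p : E n × E n) : lapV (fun _ : E n × E n => c) p = 0 := by
  simp [lapV, pd_const]

lemma lapV_exp {φ : E n × E n → ℝ} (hφ : ContDiff ℝ ∞ φ) (p : E n × E n) :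
    lapV (fun p => Real.exp (φ p)) p
      = Real.exp (φ p) * (lapV φ p + ∑ i : Fin n, pd φ (Sum.inr i) p ^ 2) := by
  simp only [lapV, pd_exp hφ.diff, pd_mul hφ.exp.diff (contDiff_pd hφ _).diff, mul_add,
    Finset.mul_sum, ← Finset.sum_add_distrib]
  refine Finset.sum_congr rfl fun i _ => ?_
  ring

lemma lapV_comp_add (φ : E n × E n → ℝ) (z p : E n × E n) :
    lapV (fun p => φ (p + z)) p = lapV φ (p + z) := by
  simp only [lapV, pd_comp_add]

/-- A quadratic polynomial centred at `c`. -/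
def quad (A α β γ : ℝ) (c : E n × E n) (p : E n × E n) : ℝ :=
  A + α * ‖p.1 - c.1‖ ^ 2 + β * inner ℝ (p.1 - c.1) (p.2 - c.2) + γ * ‖p.2 - c.2‖ ^ 2

lemma contDiff_quad (A α β γ : ℝ) (c : E n × E n) : ContDiff ℝ ∞ (quad A α β γ c) := by
  unfold quad
  have h1 : ContDiff ℝ ∞ fun p : E n × E n => p.1 - c.1 := by fun_prop
  have h2 : ContDiff ℝ ∞ fun p : E n × E n => p.2 - c.2 := by fun_prop
  exact ((contDiff_const.add (contDiff_const.mul (h1.norm_sq ℝ))).add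
    (contDiff_const.mul (h1.inner ℝ h2))).add (contDiff_const.mul (h2.norm_sq ℝ))

lemma fderiv_quad (A α β γ : ℝ) (c p z : E n × E n) :
    fderiv ℝ (quad A α β γ c) p z = 2 * α * inner ℝ (p.1 - c.1) z.1
      + β * (inner ℝ (p.1 - c.1) z.2 + inner ℝ z.1 (p.2 - c.2))
      + 2 * γ * inner ℝ (p.2 - c.2) z.2 := by
  have h1 : HasFDerivAt (fun p : E n × E n => p.1 - c.1) (ContinuousLinearMap.fst ℝ _ _) p :=
    (hasFDerivAt_fst).sub_const _
  have h2 : HasFDerivAt (fun p : E n × E n => p.2 - c.2) (ContinuousLinearMap.snd ℝ _ _) p :=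
    (hasFDerivAt_snd).sub_const _
  have := (((h1.norm_sq.const_mul α).const_add A).add ((h1.inner ℝ h2).const_mul β)).add
    (h2.norm_sq.const_mul γ)
  have h3 := HasFDerivAt.fderiv this
  unfold quad
  erw [h3]
  simp [fderivInnerCLM_apply, inner_sub_left, inner_sub_right]
  ring

lemma pd_quad_inl (A α β γ : ℝ) (c : E n × E n) (i : Fin n) (p : E n × E n) :
    pd (quad A α β γ c) (Sum.inl i) p = 2 * α * (p.1 - c.1) i + β * (p.2 - c.2) i := by
  simp [pd, fderiv_quad, _root_.stdBasis, EuclideanSpace.inner_single_left,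
    EuclideanSpace.inner_single_right]

lemma pd_quad_inr (A α β γ : ℝ) (c : E n × E n) (i : Fin n) (p : E n × E n) :
    pd (quad A α β γ c) (Sum.inr i) p = β * (p.1 - c.1) i + 2 * γ * (p.2 - c.2) i := by
  simp [pd, fderiv_quad, _root_.stdBasis, EuclideanSpace.inner_single_right]

lemma lapV_quad (A α β γ : ℝ) (c p : E n × E n) :
    lapV (quad A α β γ c) p = 2 * n * γ := by
  have key : ∀ i, pd (pd (quad A α β γ c) (Sum.inr i)) (Sum.inr i) p = 2 * γ := by
    intro i
    have h : pd (quad A α β γ c) (Sum.inr i) = fun p =>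
        ((β • (EuclideanSpace.proj i).comp (ContinuousLinearMap.fst ℝ (E n) (E n))
          + (2 * γ) • (EuclideanSpace.proj i).comp (ContinuousLinearMap.snd ℝ (E n) (E n)) :
            E n × E n →L[ℝ] ℝ) p) + (-(β * c.1 i) - 2 * γ * c.2 i) := by
      ext p
      rw [pd_quad_inr]
      simp
      ring
    rw [h]
    simp only [pd, fderiv_add_const, ContinuousLinearMap.fderiv]
    simp [_root_.stdBasis]
  simp only [lapV, key, Finset.sum_const, Finset.card_univ, Fintype.card_fin, nsmul_eq_mul]
  ring

lemma kin_quad (A α β γ : ℝ) (c p : E n × E n) :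
    kin (quad A α β γ c) p = 2 * n * γ
      + (β ^ 2 * ‖p.1 - c.1‖ ^ 2 + 4 * β * γ * inner ℝ (p.1 - c.1) (p.2 - c.2)
        + 4 * γ ^ 2 * ‖p.2 - c.2‖ ^ 2)
      - (2 * α * inner ℝ p.2 (p.1 - c.1) + β * inner ℝ p.2 (p.2 - c.2)) := by
  simp only [kin, lapV_quad, pd_quad_inl, pd_quad_inr, EuclideanSpace.real_norm_sq_eq,
    PiLp.inner_apply, RCLike.inner_apply, conj_trivial, Finset.mul_sum,
    ← Finset.sum_add_distrib]
  congr 1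
  · congr 1
    refine Finset.sum_congr rfl fun i _ => ?_
    ring
  · refine Finset.sum_congr rfl fun i _ => ?_
    ring

lemma hasDerivAt_line {φ : E n × E n → ℝ} (hφ : Differentiable ℝ φ) (p z : E n × E n) (s : ℝ) :
    HasDerivAt (fun s : ℝ => φ (p + s • z)) (∑ j, coords z j * pd φ j (p + s • z)) s := by
  rw [← fderiv_apply_eq_sum]
  have h : HasDerivAt (fun s : ℝ => p + s • z) z s := by
    simpa using ((hasDerivAt_id s).smul_const z).const_add p
  exact (hφ (p + s • z)).hasFDerivAt.comp_hasDerivAt s h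

lemma hasDerivAt_line_pd {φ : E n × E n → ℝ} (hφ : ContDiff ℝ ∞ φ) (p z : E n × E n) (s : ℝ) :
    HasDerivAt (fun s : ℝ => ∑ j, coords z j * pd φ j (p + s • z))
      (coords z ⬝ᵥ (Hess φ (p + s • z) *ᵥ coords z)) s := by
  have h := HasDerivAt.fun_sum (u := Finset.univ) fun j _ =>
    (hasDerivAt_line (contDiff_pd hφ j).diff p z s).const_mul (coords z j)
  refine h.congr_deriv ?_
  simp only [dotProduct, mulVec, Hess, of_apply, Finset.mul_sum]
  rw [Finset.sum_comm]
  refine Finset.sum_congr rfl fun i _ => Finset.sum_congr rfl fun j _ => ?_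
  ring

/-- Second-order Taylor lower bound on the unit interval. -/
lemma taylor_lower_bound {f f' f'' : ℝ → ℝ} (hf : ∀ s, HasDerivAt f (f' s) s)
    (hf' : ∀ s, HasDerivAt f' (f'' s) s) {κ : ℝ} (h : ∀ s ∈ Icc (0 : ℝ) 1, -κ ≤ f'' s) :
    f 0 + f' 0 - κ / 2 ≤ f 1 := by
  have h1 : ∀ s ∈ Icc (0 : ℝ) 1, 0 ≤ f' s - f' 0 + κ * s := by
    have hm : MonotoneOn (fun s => f' s - f' 0 + κ * s) (Icc 0 1) := by
      have hd : ∀ s, HasDerivAt (fun s => f' s - f' 0 + κ * s) (f'' s + κ) s := fun s =>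
        (((hf' s).sub_const (f' 0)).add ((hasDerivAt_id s).const_mul κ)).congr_deriv (by simp)
      refine monotoneOn_of_deriv_nonneg (convex_Icc 0 1)
        (fun s _ => (hd s).continuousAt.continuousWithinAt)
        (fun s _ => (hd s).differentiableAt.differentiableWithinAt) fun s hs => ?_
      rw [(hd s).deriv]
      linarith [h s (interior_subset hs)]
    intro s hs
    simpa using hm (left_mem_Icc.2 zero_le_one) hs hs.1
  have hm : MonotoneOn (fun s => f s - f' 0 * s + κ / 2 * s ^ 2) (Icc 0 1) := by
    have hd : ∀ s, HasDerivAt (fun s => f s - f' 0 * s + κ / 2 * s ^ 2)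
        (f' s - f' 0 + κ * s) s := fun s => by
      refine (((hf s).sub ((hasDerivAt_id s).const_mul (f' 0))).add
        ((hasDerivAt_pow 2 s).const_mul (κ / 2))).congr_deriv ?_
      simp
      ring
    refine monotoneOn_of_deriv_nonneg (convex_Icc 0 1)
      (fun s _ => (hd s).continuousAt.continuousWithinAt)
      (fun s _ => (hd s).differentiableAt.differentiableWithinAt) fun s hs => ?_
    rw [(hd s).deriv]
    exact h1 s (interior_subset hs)
  have := hm (left_mem_Icc.2 zero_le_one) (right_mem_Icc.2 zero_le_one) zero_le_one
  simp at this
  linarith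

/-- A quadratic lower bound obtained from a lower bound of the Hessian on a segment. -/
lemma tangent_lower_bound {φ : E n × E n → ℝ} (hφ : ContDiff ℝ ∞ φ) (p z : E n × E n) {κ : ℝ}
    (h : ∀ s ∈ Icc (0 : ℝ) 1, -κ ≤ coords z ⬝ᵥ (Hess φ (p + s • z) *ᵥ coords z)) :
    φ p + fderiv ℝ φ p z - κ / 2 ≤ φ (p + z) := by
  have := taylor_lower_bound (hasDerivAt_line hφ.diff p z) (hasDerivAt_line_pd hφ p z) h
  simpa [fderiv_apply_eq_sum] using this

/-- The second derivative test at a minimum. -/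
lemma second_deriv_nonneg_of_min {f f' : ℝ → ℝ} {c : ℝ} (hf : ∀ s, HasDerivAt f (f' s) s)
    (hf' : HasDerivAt f' c 0) (hmin : ∀ s, f 0 ≤ f s) : f' 0 = 0 ∧ 0 ≤ c := by
  have h0 : f' 0 = 0 :=
    IsLocalMin.hasDerivAt_eq_zero (Filter.Eventually.of_forall hmin) (hf 0)
  refine ⟨h0, ?_⟩
  by_contra! hc
  have hd : deriv f = f' := funext fun s => (hf s).deriv
  have hmax : IsLocalMax f 0 := by
    refine isLocalMax_of_deriv_deriv_neg ?_ (by rw [hd, h0]) (hf 0).continuousAt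
    rwa [hd, hf'.deriv]
  have hconst : f =ᶠ[nhds 0] fun _ => f 0 := by
    filter_upwards [hmax] with s hs using le_antisymm hs (hmin s)
  have hd0 : f' =ᶠ[nhds 0] fun _ => 0 := by
    have := hconst.deriv
    rw [hd] at this
    simpa using this
  have := hd0.deriv_eq
  rw [hf'.deriv] at this
  simp at this
  linarith

lemma pd_eq_zero_of_min {φ : E n × E n → ℝ} {p : E n × E n}
    (hmin : ∀ q, φ p ≤ φ q) (j : Fin n ⊕ Fin n) : pd φ j p = 0 := by
  have : IsLocalMin φ p := Filter.Eventually.of_forall hmin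
  simp [pd, this.fderiv_eq_zero]

lemma coords_stdBasis (j : Fin n ⊕ Fin n) : coords (_root_.stdBasis n j) = Pi.single j 1 := by
  ext k
  rcases j with j | j <;> rcases k with k | k <;>
    simp [coords, _root_.stdBasis, Pi.single_apply]

lemma lapV_nonneg_of_min {φ : E n × E n → ℝ} (hφ : ContDiff ℝ ∞ φ) {p : E n × E n}
    (hmin : ∀ q, φ p ≤ φ q) : 0 ≤ lapV φ p := by
  refine Finset.sum_nonneg fun i _ => ?_
  have := (second_deriv_nonneg_of_min (hasDerivAt_line hφ.diff p (_root_.stdBasis n (Sum.inr i)))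
    (hasDerivAt_line_pd hφ p (_root_.stdBasis n (Sum.inr i)) 0) (fun s => by simpa using hmin _)).2
  simpa [coords_stdBasis, Hess] using this

end Calculus

section MaximumPrinciple

variable {n : ℕ}

lemma exists_neg_min {F : ℝ → E n × E n → ℝ} {t₀ t₁ r : ℝ}
    (hF : ContinuousOn (fun q : ℝ × (E n × E n) => F q.1 q.2) (Icc t₀ t₁ ×ˢ univ))
    (hinit : ∀ p, 0 ≤ F t₀ p) (hout : ∀ t ∈ Icc t₀ t₁, ∀ p, r ≤ nsq p → 0 ≤ F t p)
    {t : ℝ} (ht : t ∈ Icc t₀ t₁) {p : E n × E n} (hneg : F t p < 0) :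
    ∃ τ ∈ Ioc t₀ t₁, ∃ q, F τ q < 0 ∧ ∀ τ' ∈ Icc t₀ t₁, ∀ q', F τ q ≤ F τ' q' := by
  have hp : nsq p ≤ r := by
    by_contra! h
    linarith [hout t ht p h.le]
  obtain ⟨⟨τ, q⟩, ⟨hτ, -⟩, hmin⟩ := (isCompact_Icc.prod (isCompact_nsq_le (n := n) r)).exists_isMinOn
    ⟨(t, p), ht, hp⟩ (hF.mono (prod_mono_right (subset_univ _)))
  have hle : F τ q ≤ F t p := hmin (show (t, p) ∈ _ from ⟨ht, hp⟩)
  have hlt : F τ q < 0 := hle.trans_lt hneg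
  refine ⟨τ, ⟨lt_of_le_of_ne hτ.1 ?_, hτ.2⟩, q, hlt, fun τ' hτ' q' => ?_⟩
  · rintro rfl
    linarith [hinit q]
  · rcases le_total r (nsq q') with h | h
    · linarith [hout τ' hτ' q' h]
    · exact hmin (show (τ', q') ∈ _ from ⟨hτ', h⟩)

lemma deriv_nonpos_of_min {f : ℝ → ℝ} {d t₀ t : ℝ} (hf : HasDerivAt f d t) (ht : t₀ < t)
    (hmin : ∀ τ ∈ Icc t₀ t, f t ≤ f τ) : d ≤ 0 := by
  have h := (hasDerivAt_iff_tendsto_slope_left_right.1 hf).1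
  refine le_of_tendsto h ?_
  filter_upwards [Ioo_mem_nhdsLT ht] with τ hτ
  rw [slope_def_field]
  exact div_nonpos_of_nonneg_of_nonpos (by linarith [hmin τ ⟨hτ.1.le, hτ.2.le⟩]) (by linarith [hτ.2])

lemma kin_sub_kin {φ ψ : E n × E n → ℝ} (hφ : ContDiff ℝ ∞ φ) (hψ : ContDiff ℝ ∞ ψ)
    (p : E n × E n) : kin φ p - kin ψ p = lapV (fun q => φ q - ψ q) p
      + (∑ i : Fin n, pd (fun q => φ q - ψ q) (Sum.inr i) p ^ 2)
      + ∑ i : Fin n, (2 * pd ψ (Sum.inr i) p * pd (fun q => φ q - ψ q) (Sum.inr i) p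
        - p.2 i * pd (fun q => φ q - ψ q) (Sum.inl i) p) := by
  simp only [kin, lapV_sub hφ hψ, pd_sub hφ.diff hψ.diff]
  have h1 : ∑ i : Fin n, pd φ (Sum.inr i) p ^ 2 - ∑ i : Fin n, p.2 i * pd φ (Sum.inl i) p
      - (∑ i : Fin n, pd ψ (Sum.inr i) p ^ 2 - ∑ i : Fin n, p.2 i * pd ψ (Sum.inl i) p)
      = ∑ i : Fin n, (pd φ (Sum.inr i) p - pd ψ (Sum.inr i) p) ^ 2
      + ∑ i : Fin n, (2 * pd ψ (Sum.inr i) p * (pd φ (Sum.inr i) p - pd ψ (Sum.inr i) p)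
        - p.2 i * (pd φ (Sum.inl i) p - pd ψ (Sum.inl i) p)) := by
    simp only [← Finset.sum_sub_distrib, ← Finset.sum_add_distrib]
    refine Finset.sum_congr rfl fun i _ => ?_
    ring
  linarith

/-- Comparison between a solution `ℓ` and a supersolution `L`, given a strict supersolution `β`
which dominates `ℓ` at infinity. -/
lemma comparison_of_barrier {h : E n × E n → ℝ} {L L' ℓ ℓ' β β' : ℝ → E n × E n → ℝ} {t₀ t₁ : ℝ}
    (cL : ContinuousOn (fun q : ℝ × (E n × E n) => L q.1 q.2) (Icc t₀ t₁ ×ˢ univ))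
    (cℓ : ContinuousOn (fun q : ℝ × (E n × E n) => ℓ q.1 q.2) (Icc t₀ t₁ ×ˢ univ))
    (cβ : ContinuousOn (fun q : ℝ × (E n × E n) => β q.1 q.2) (Icc t₀ t₁ ×ˢ univ))
    (sL : ∀ t ∈ Icc t₀ t₁, ContDiff ℝ ∞ (L t)) (sℓ : ∀ t ∈ Icc t₀ t₁, ContDiff ℝ ∞ (ℓ t))
    (sβ : ∀ t ∈ Icc t₀ t₁, ContDiff ℝ ∞ (β t))
    (dL : ∀ t ∈ Icc t₀ t₁, ∀ p, HasDerivAt (fun τ => L τ p) (L' t p) t)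
    (dℓ : ∀ t ∈ Icc t₀ t₁, ∀ p, HasDerivAt (fun τ => ℓ τ p) (ℓ' t p) t)
    (dβ : ∀ t ∈ Icc t₀ t₁, ∀ p, HasDerivAt (fun τ => β τ p) (β' t p) t)
    (eL : ∀ t ∈ Icc t₀ t₁, ∀ p, kin (L t) p + h p ≤ L' t p)
    (eℓ : ∀ t ∈ Icc t₀ t₁, ∀ p, ℓ' t p = kin (ℓ t) p + h p)
    (eβ : ∀ t ∈ Icc t₀ t₁, ∀ p, kin (β t) p + h p < β' t p)
    (hinit : ∀ p, ℓ t₀ p ≤ L t₀ p)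
    (hgrow : ∀ B : ℝ, ∃ r : ℝ, ∀ t ∈ Icc t₀ t₁, ∀ p, r ≤ nsq p → ℓ t p ≤ β t p - B)
    {t : ℝ} (ht : t ∈ Icc t₀ t₁) (p : E n × E n) : ℓ t p ≤ L t p := by
  by_contra! hlt
  set δ := 1 - Real.exp (L t p - ℓ t p) with hδ
  have hδ0 : 0 < δ := by
    have : Real.exp (L t p - ℓ t p) < 1 := Real.exp_lt_one_iff.2 (by linarith)
    linarith
  set B := β t p - ℓ t p - Real.log (δ / 2) with hB
  obtain ⟨r, hr⟩ := hgrow B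
  set F : ℝ → E n × E n → ℝ := fun τ q =>
    Real.exp (L τ q - ℓ τ q) + Real.exp (-B) * Real.exp (β τ q - ℓ τ q) - 1 with hF
  have cF : ContinuousOn (fun q : ℝ × (E n × E n) => F q.1 q.2) (Icc t₀ t₁ ×ˢ univ) :=
    ((cL.sub cℓ).rexp.add (continuousOn_const.mul (cβ.sub cℓ).rexp)).sub continuousOn_const
  have hneg : F t p < 0 := by
    have : Real.exp (-B) * Real.exp (β t p - ℓ t p) = δ / 2 := by
      rw [← Real.exp_add, show -B + (β t p - ℓ t p) = Real.log (δ / 2) by rw [hB]; ring,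
        Real.exp_log (by linarith)]
    simp only [hF, this]
    linarith
  obtain ⟨τ, hτ, q, -, hmin⟩ := exists_neg_min (r := r) cF
    (fun q => by
      have h1 : 1 ≤ Real.exp (L t₀ q - ℓ t₀ q) := Real.one_le_exp (by linarith [hinit q])
      have h2 := mul_pos (Real.exp_pos (-B)) (Real.exp_pos (β t₀ q - ℓ t₀ q))
      simp only [hF]
      linarith)
    (fun τ hτ q hq => by
      have h1 : 1 ≤ Real.exp (-B) * Real.exp (β τ q - ℓ τ q) := by
        rw [← Real.exp_add]
        exact Real.one_le_exp (by linarith [hr τ hτ q hq])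
      have h2 := Real.exp_pos (L τ q - ℓ τ q)
      simp only [hF]
      linarith) ht hneg
  have hτ' : τ ∈ Icc t₀ t₁ := Ioc_subset_Icc_self hτ
  have hderiv : Real.exp (L τ q - ℓ τ q) * (L' τ q - ℓ' τ q)
      + Real.exp (-B) * (Real.exp (β τ q - ℓ τ q) * (β' τ q - ℓ' τ q)) ≤ 0 :=
    deriv_nonpos_of_min (t₀ := t₀)
      ((((dL τ hτ' q).sub (dℓ τ hτ' q)).exp.add
        (((dβ τ hτ' q).sub (dℓ τ hτ' q)).exp.const_mul (Real.exp (-B)))).sub_const 1) hτ.1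
      fun τ' hτ'' => hmin τ' ⟨hτ''.1, hτ''.2.trans hτ.2⟩ q
  have sa : ContDiff ℝ ∞ fun q => L τ q - ℓ τ q := (sL τ hτ').sub (sℓ τ hτ')
  have sb : ContDiff ℝ ∞ fun q => β τ q - ℓ τ q := (sβ τ hτ').sub (sℓ τ hτ')
  have sb' : ContDiff ℝ ∞ fun q => Real.exp (-B) * Real.exp (β τ q - ℓ τ q) :=
    contDiff_const.mul sb.exp
  have sab : ContDiff ℝ ∞ fun q =>
      Real.exp (L τ q - ℓ τ q) + Real.exp (-B) * Real.exp (β τ q - ℓ τ q) := sa.exp.add sb'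
  have sF : ContDiff ℝ ∞ (F τ) := sab.sub contDiff_const
  have hlap := lapV_nonneg_of_min sF fun q' => hmin τ hτ' q'
  have hgrad := fun j => pd_eq_zero_of_min (fun q' => hmin τ hτ' q') j
  simp only [hF] at hlap hgrad
  rw [lapV_sub sab contDiff_const, lapV_const, lapV_add sa.exp sb', lapV_const_mul sb.exp,
    lapV_exp sa, lapV_exp sb, sub_zero] at hlap
  simp only [pd_sub sab.diff (differentiable_const _), pd_const, pd_add sa.exp.diff sb'.diff,
    pd_const_mul sb.exp.diff, pd_exp sa.diff, pd_exp sb.diff, sub_zero] at hgrad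
  have hL := kin_sub_kin (sL τ hτ') (sℓ τ hτ') q
  have hβ := kin_sub_kin (sβ τ hτ') (sℓ τ hτ') q
  have hsum : Real.exp (L τ q - ℓ τ q) * (∑ i : Fin n,
        (2 * pd (ℓ τ) (Sum.inr i) q * pd (fun q => L τ q - ℓ τ q) (Sum.inr i) q
        - q.2 i * pd (fun q => L τ q - ℓ τ q) (Sum.inl i) q))
      + Real.exp (-B) * (Real.exp (β τ q - ℓ τ q) * ∑ i : Fin n,
        (2 * pd (ℓ τ) (Sum.inr i) q * pd (fun q => β τ q - ℓ τ q) (Sum.inr i) q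
        - q.2 i * pd (fun q => β τ q - ℓ τ q) (Sum.inl i) q)) = 0 := by
    rw [Finset.mul_sum, Finset.mul_sum, Finset.mul_sum, ← Finset.sum_add_distrib]
    refine Finset.sum_eq_zero fun i _ => ?_
    linear_combination 2 * pd (ℓ τ) (Sum.inr i) q * hgrad (Sum.inr i)
      - q.2 i * hgrad (Sum.inl i)
  have h1 := eL τ hτ' q
  have h2 := eβ τ hτ' q
  have h3 := eℓ τ hτ' q
  have ea := Real.exp_pos (L τ q - ℓ τ q)
  have eb := mul_pos (Real.exp_pos (-B)) (Real.exp_pos (β τ q - ℓ τ q))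
  have h4 : Real.exp (L τ q - ℓ τ q) * (kin (L τ) q - kin (ℓ τ) q)
      ≤ Real.exp (L τ q - ℓ τ q) * (L' τ q - ℓ' τ q) :=
    mul_le_mul_of_nonneg_left (by linarith) ea.le
  have h5 : Real.exp (-B) * Real.exp (β τ q - ℓ τ q) * (kin (β τ) q - kin (ℓ τ) q)
      < Real.exp (-B) * Real.exp (β τ q - ℓ τ q) * (β' τ q - ℓ' τ q) :=
    mul_lt_mul_of_pos_left (by linarith) eb
  rw [hL] at h4
  rw [hβ] at h5
  linarith

end MaximumPrinciple

section LowerBounds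

variable {n : ℕ}

/-- Comparison of a stationary solution `exp u` with a truncated subsolution `exp L - exp κ`. -/
lemma subsolution_le {u h : E n × E n → ℝ} (hu : ContDiff ℝ ∞ u) (eu : ∀ p, kin u p + h p = 0)
    {L L' : ℝ → E n × E n → ℝ} {s₀ s₁ lam κ N r : ℝ} (hlam : 0 ≤ lam) (hN : 0 < N)
    (cL : ContinuousOn (fun q : ℝ × (E n × E n) => L q.1 q.2) (Icc s₀ s₁ ×ˢ univ))
    (sL : ∀ s ∈ Icc s₀ s₁, ContDiff ℝ ∞ (L s))
    (dL : ∀ s ∈ Icc s₀ s₁, ∀ p, HasDerivAt (fun τ => L τ p) (L' s p) s)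
    (eL : ∀ s ∈ Icc s₀ s₁, ∀ p, L' s p < kin (L s) p - lam)
    (hreg : ∀ s ∈ Icc s₀ s₁, ∀ p, κ < L s p → -lam ≤ h p)
    (hout : ∀ s ∈ Icc s₀ s₁, ∀ p, r ≤ nsq p → L s p ≤ κ)
    (hinit : ∀ p, N * (Real.exp (L s₀ p) - Real.exp κ) ≤ Real.exp (u p))
    {s : ℝ} (hs : s ∈ Icc s₀ s₁) (p : E n × E n) :
    N * (Real.exp (L s p) - Real.exp κ) ≤ Real.exp (u p) := by
  by_contra! hlt
  set F : ℝ → E n × E n → ℝ := fun s p =>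
    Real.exp (u p) - (N * Real.exp (L s p) - N * Real.exp κ) with hF
  have cF : ContinuousOn (fun q : ℝ × (E n × E n) => F q.1 q.2) (Icc s₀ s₁ ×ˢ univ) :=
    ((hu.continuous.comp continuous_snd).rexp.continuousOn).sub
      ((continuousOn_const.mul cL.rexp).sub continuousOn_const)
  obtain ⟨τ, hτ, q, hneg, hmin⟩ := exists_neg_min (r := r) cF
    (fun q => by simp only [hF]; linarith [hinit q])
    (fun τ hτ q hq => by
      have h1 := Real.exp_le_exp.2 (hout τ hτ q hq)
      have h2 := Real.exp_pos (u q)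
      have h3 := mul_le_mul_of_nonneg_left h1 hN.le
      simp only [hF]; linarith) hs (p := p) (by simp only [hF]; linarith)
  have hτ' : τ ∈ Icc s₀ s₁ := Ioc_subset_Icc_self hτ
  have hderiv : -(N * (Real.exp (L τ q) * L' τ q)) ≤ 0 := by
    have := deriv_nonpos_of_min (t₀ := s₀)
      ((((dL τ hτ' q).exp.const_mul N).sub_const (N * Real.exp κ)).const_sub (Real.exp (u q))) hτ.1
      fun τ' hτ'' => hmin τ' ⟨hτ''.1, hτ''.2.trans hτ.2⟩ q
    exact this
  have sL' : ContDiff ℝ ∞ fun q => N * Real.exp (L τ q) := contDiff_const.mul (sL τ hτ').exp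
  have sLc : ContDiff ℝ ∞ fun q => N * Real.exp (L τ q) - N * Real.exp κ := sL'.sub contDiff_const
  have hlap := lapV_nonneg_of_min (hu.exp.sub sLc) fun q' => hmin τ hτ' q'
  have hgrad := fun j => pd_eq_zero_of_min (fun q' => hmin τ hτ' q') j
  simp only [hF] at hgrad
  rw [lapV_sub hu.exp sLc, lapV_sub sL' contDiff_const, lapV_const, lapV_const_mul (sL τ hτ').exp,
    lapV_exp hu, lapV_exp (sL τ hτ'), sub_zero] at hlap
  simp only [pd_sub hu.exp.diff sLc.diff, pd_sub sL'.diff (differentiable_const _), pd_const,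
    pd_const_mul (sL τ hτ').exp.diff, pd_exp hu.diff, pd_exp (sL τ hτ').diff, sub_zero] at hgrad
  have hsum : Real.exp (u q) * (∑ i : Fin n, q.2 i * pd u (Sum.inl i) q)
      - N * (Real.exp (L τ q) * ∑ i : Fin n, q.2 i * pd (L τ) (Sum.inl i) q) = 0 := by
    rw [Finset.mul_sum, Finset.mul_sum, Finset.mul_sum, ← Finset.sum_sub_distrib]
    refine Finset.sum_eq_zero fun i _ => ?_
    linear_combination q.2 i * hgrad (Sum.inl i)
  have hkin : 0 ≤ Real.exp (u q) * kin u q - N * (Real.exp (L τ q) * kin (L τ) q) := by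
    unfold kin
    linarith
  have eL1 := Real.exp_pos (L τ q)
  have eu1 := Real.exp_pos (u q)
  have hlt1 : N * (Real.exp (L τ q) * (L' τ q + lam)) < N * (Real.exp (L τ q) * kin (L τ) q) :=
    mul_lt_mul_of_pos_left (mul_lt_mul_of_pos_left (by linarith [eL τ hτ' q]) eL1) hN
  have hF1 : Real.exp (u q) < N * (Real.exp (L τ q) - Real.exp κ) := by
    simp only [hF] at hneg
    linarith
  have hκ : κ < L τ q := by
    by_contra! hle
    have := mul_nonpos_of_nonneg_of_nonpos hN.le (sub_nonpos.2 (Real.exp_le_exp.2 hle))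
    linarith
  have h1 := hreg τ hτ' q hκ
  have h2 : Real.exp (u q) < N * Real.exp (L τ q) := by
    have := mul_pos hN (Real.exp_pos κ)
    linarith
  have h3 : kin u q = - h q := by linarith [eu q]
  rw [h3] at hkin
  nlinarith [mul_le_mul_of_nonneg_left h2.le hlam, mul_le_mul_of_nonneg_left h1 eu1.le]

/-- The exponent of the Gaussian kernel of `∂ₛ - Δ_v + ⟨v, ∇ₓ⟩ + lam`, started near `c` at
time `s₀`. -/
def gaussExp (n : ℕ) (lam s₀ : ℝ) (c : E n × E n) (s : ℝ) : E n × E n → ℝ :=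
  quad (-(2 * n * Real.log s) - lam * s) (-3 / s ^ 3) (3 / s ^ 2) (-1 / s)
    (c.1 + (s - s₀) • c.2, c.2)

lemma hasDerivAt_gaussExp (lam s₀ : ℝ) (c p : E n × E n) {s : ℝ} (hs : s ≠ 0) :
    HasDerivAt (fun τ => gaussExp n lam s₀ c τ p) (kin (gaussExp n lam s₀ c s) p - lam) s := by
  have hz : HasDerivAt (fun τ : ℝ => p.1 - (c.1 + (τ - s₀) • c.2)) (-c.2) s := by
    simpa using ((((hasDerivAt_id s).sub_const s₀).smul_const c.2).const_add c.1).const_sub p.1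
  have hA : HasDerivAt (fun τ : ℝ => -(2 * n * Real.log τ) - lam * τ) (-(2 * n * s⁻¹) - lam) s :=
    ((((Real.hasDerivAt_log hs).const_mul (2 * n : ℝ)).neg).sub
      ((hasDerivAt_id s).const_mul lam)).congr_deriv (by simp)
  have h3 : HasDerivAt (fun τ : ℝ => -3 / τ ^ 3) (9 / s ^ 4) s := by
    refine ((hasDerivAt_const s (-3 : ℝ)).div (hasDerivAt_pow 3 s) (pow_ne_zero 3 hs)).congr_deriv ?_
    field_simp
    ring
  have h2 : HasDerivAt (fun τ : ℝ => 3 / τ ^ 2) (-6 / s ^ 3) s := by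
    refine ((hasDerivAt_const s (3 : ℝ)).div (hasDerivAt_pow 2 s) (pow_ne_zero 2 hs)).congr_deriv ?_
    field_simp
    ring
  have h1 : HasDerivAt (fun τ : ℝ => -1 / τ) (1 / s ^ 2) s := by
    refine ((hasDerivAt_const s (-1 : ℝ)).div (hasDerivAt_id s) hs).congr_deriv ?_
    simp
  have hmain := ((hA.add (h3.mul hz.norm_sq)).add (h2.mul (hz.inner ℝ
    (hasDerivAt_const s (p.2 - c.2))))).add (h1.mul_const (‖p.2 - c.2‖ ^ 2))
  refine HasDerivAt.congr_deriv (f := fun τ => gaussExp n lam s₀ c τ p) hmain ?_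
  unfold gaussExp
  rw [kin_quad]
  simp only
  set a := p.1 - (c.1 + (s - s₀) • c.2) with ha
  have hp : p.2 = (p.2 - c.2) + c.2 := by abel
  set b := p.2 - c.2 with hb
  rw [hp]
  simp only [inner_add_left, inner_neg_right, inner_neg_left, inner_zero_right,
    real_inner_self_eq_norm_sq]
  rw [real_inner_comm a b, real_inner_comm a c.2]
  field_simp
  ring

lemma contDiff_gaussExp (lam s₀ : ℝ) (c : E n × E n) (s : ℝ) :
    ContDiff ℝ ∞ (gaussExp n lam s₀ c s) := contDiff_quad _ _ _ _ _

lemma continuousOn_gaussExp (lam s₀ : ℝ) (c : E n × E n) {s₁ s₂ : ℝ} (hs : 0 < s₁) :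
    ContinuousOn (fun q : ℝ × (E n × E n) => gaussExp n lam s₀ c q.1 q.2)
      (Icc s₁ s₂ ×ˢ univ) := by
  have hne : ∀ q ∈ Icc s₁ s₂ ×ˢ (univ : Set (E n × E n)), q.1 ≠ 0 := fun q hq =>
    (hs.trans_le hq.1.1).ne'
  have hne' : ∀ k : ℕ, ∀ q ∈ Icc s₁ s₂ ×ˢ (univ : Set (E n × E n)), q.1 ^ k ≠ 0 := fun k q hq =>
    pow_ne_zero k (hne q hq)
  unfold gaussExp quad
  refine ContinuousOn.add (ContinuousOn.add (ContinuousOn.add ?_ ?_) ?_) ?_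
  · exact ((continuousOn_const.mul (continuousOn_fst.log hne)).neg).sub
      (continuousOn_const.mul continuousOn_fst)
  · exact (continuousOn_const.div (by fun_prop) (hne' 3)).mul (by fun_prop)
  · exact (continuousOn_const.div (by fun_prop) (hne' 2)).mul (by fun_prop)
  · exact (continuousOn_const.div (by fun_prop) hne).mul (by fun_prop)

/-- The centre of the Gaussian kernel at time `s`. -/
def gaussCenter (s₀ : ℝ) (c : E n × E n) (s : ℝ) : E n × E n := (c.1 + (s - s₀) • c.2, c.2)

lemma nsq_gaussCenter_le {s₀ s : ℝ} (c : E n × E n) (h0 : s₀ ≤ s) (h1 : s - s₀ ≤ 1) :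
    nsq (gaussCenter s₀ c s) ≤ 4 * nsq c := by
  have h : gaussCenter s₀ c s = c + (s - s₀) • (c.2, 0) := by
    ext <;> simp [gaussCenter]
  have h2 : nsq ((c.2, 0) : E n × E n) ≤ nsq c := by simp [nsq]
  have h3 := nsq_add_le c ((s - s₀) • (c.2, 0))
  rw [nsq_smul] at h3
  have h4 : (s - s₀) ^ 2 ≤ 1 := by nlinarith
  rw [h]
  nlinarith [nsq_nonneg c, nsq_nonneg ((c.2, 0) : E n × E n)]

lemma gaussExp_le (lam s₀ : ℝ) (c p : E n × E n) {s : ℝ} (hs : 0 < s) (hs1 : s ≤ 1) :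
    gaussExp n lam s₀ c s p
      ≤ -(2 * n * Real.log s) - lam * s - nsq (p - gaussCenter s₀ c s) / (8 * s) := by
  unfold gaussExp quad nsq gaussCenter
  simp only [Prod.fst_sub, Prod.snd_sub]
  set a := p.1 - (c.1 + (s - s₀) • c.2)
  set b := p.2 - c.2
  have h1 : 1 ≤ s⁻¹ := (one_le_inv₀ hs).2 hs1
  have key : 0 ≤ ‖b - ((12 / 7) * s⁻¹) • a‖ ^ 2 := by positivity
  rw [@norm_sub_sq_real, inner_smul_right, norm_smul, mul_pow, Real.norm_eq_abs, sq_abs,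
    real_inner_comm] at key
  have e : (‖a‖ ^ 2 + ‖b‖ ^ 2) / (8 * s) = (‖a‖ ^ 2 + ‖b‖ ^ 2) * s⁻¹ / 8 := by field_simp
  rw [e, show -3 / s ^ 3 = -3 * s⁻¹ ^ 3 by field_simp, show 3 / s ^ 2 = 3 * s⁻¹ ^ 2 by field_simp,
    show -1 / s = - s⁻¹ by field_simp]
  set i := s⁻¹
  have k2 := mul_nonneg (show (0 : ℝ) ≤ i by linarith) key
  have k3 : 0 ≤ i * (i ^ 2 - 1) * ‖a‖ ^ 2 :=
    mul_nonneg (mul_nonneg (by linarith) (by nlinarith)) (by positivity)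
  have k4 : 0 ≤ i * ‖a‖ ^ 2 := mul_nonneg (by linarith) (by positivity)
  linarith

lemma le_gaussExp (lam s₀ : ℝ) (c p : E n × E n) {s : ℝ} (hs : 0 < s) (hs1 : s ≤ 1) :
    -(2 * n * Real.log s) - lam * s - 5 * nsq (p - gaussCenter s₀ c s) / s ^ 3
      ≤ gaussExp n lam s₀ c s p := by
  unfold gaussExp quad nsq gaussCenter
  simp only [Prod.fst_sub, Prod.snd_sub]
  set a := p.1 - (c.1 + (s - s₀) • c.2)
  set b := p.2 - c.2
  have h1 : 1 ≤ s⁻¹ := (one_le_inv₀ hs).2 hs1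
  have key : 0 ≤ ‖a + b‖ ^ 2 := by positivity
  rw [@norm_add_sq_real] at key
  have e : 5 * (‖a‖ ^ 2 + ‖b‖ ^ 2) / s ^ 3 = 5 * (‖a‖ ^ 2 + ‖b‖ ^ 2) * s⁻¹ ^ 3 := by field_simp
  rw [e, show -3 / s ^ 3 = -3 * s⁻¹ ^ 3 by field_simp, show 3 / s ^ 2 = 3 * s⁻¹ ^ 2 by field_simp,
    show -1 / s = - s⁻¹ by field_simp]
  set i := s⁻¹
  have i0 : 0 ≤ i := by linarith
  have i2 : i ^ 2 ≤ i ^ 3 := by nlinarith [sq_nonneg i]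
  have i1 : i ≤ i ^ 3 := by nlinarith [sq_nonneg i]
  have k2 := mul_nonneg (sq_nonneg i) key
  have k3 := mul_nonneg (sub_nonneg.2 i2) (show (0 : ℝ) ≤ ‖a‖ ^ 2 + ‖b‖ ^ 2 by positivity)
  have k4 := mul_nonneg (sub_nonneg.2 i1) (show (0 : ℝ) ≤ ‖b‖ ^ 2 by positivity)
  have k5 := mul_nonneg (pow_nonneg i0 3) (show (0 : ℝ) ≤ ‖a‖ ^ 2 by positivity)
  have k6 := mul_nonneg (pow_nonneg i0 3) (show (0 : ℝ) ≤ ‖b‖ ^ 2 by positivity)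
  linarith

end LowerBounds

section HarnackChain

variable {n : ℕ}

lemma exists_add_mul_log_le (a b : ℝ) : ∃ x : ℝ, 1 ≤ x ∧ a + b * Real.log x ≤ x / 16 := by
  have h : (fun x : ℝ => a + b * Real.log x) =o[Filter.atTop] (id : ℝ → ℝ) :=
    (Asymptotics.isLittleO_const_id_atTop a).add (Real.isLittleO_log_id_atTop.const_mul_left b)
  obtain ⟨x, hx, hx1⟩ := ((h.bound (show (0 : ℝ) < 1 / 16 by norm_num)).and
    (Filter.eventually_ge_atTop 1)).exists
  refine ⟨x, hx1, ?_⟩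
  have := (le_abs_self _).trans hx
  rw [id, Real.norm_eq_abs, abs_of_pos (by linarith)] at this
  linarith

lemma nsq_sub_le (p q : E n × E n) : nsq (p - q) ≤ 2 * nsq p + 2 * nsq q := by
  simpa [sub_eq_add_neg, nsq_neg] using nsq_add_le p (-q)

set_option maxHeartbeats 1000000 in
/-- A Harnack inequality for positive stationary solutions: a lower bound for `u` on a small ball
propagates to points at a comparable distance from the origin. -/
lemma harnack_chain {u h : E n × E n → ℝ} (hu : ContDiff ℝ ∞ u) (eu : ∀ p, kin u p + h p = 0)
    {C₀ c₁ : ℝ} (hC₀ : 0 ≤ C₀) (hlow : ∀ p, -(C₀ * (1 + nsq p)) ≤ h p) (hc₁ : 0 ≤ c₁) :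
    ∃ C : ℝ, 0 ≤ C ∧ ∀ m : ℝ, 1 ≤ m → ∀ p' q : E n × E n, nsq p' ≤ m → nsq q ≤ m → ∀ N₀ : ℝ,
      (∀ p, nsq (p - p') ≤ Real.exp (-(2 * c₁ * m)) → N₀ ≤ u p) → N₀ - C * m ≤ u q := by
  set S : ℝ := 1 / (32 * (C₀ + 1)) with hS
  have hS0 : 0 < S := by positivity
  have hS1 : S ≤ 1 := by
    rw [hS, div_le_one (by positivity)]
    linarith
  obtain ⟨C₂, hC₂, hC₂'⟩ := exists_add_mul_log_le (2 + 50 / S ^ 3 + 2 * n * (2 * c₁ + 1)) (2 * n)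
  have hlog : 0 ≤ Real.log C₂ := Real.log_nonneg hC₂
  have hn0 : (0 : ℝ) ≤ 2 * n := by positivity
  have hSi : 0 ≤ 50 / S ^ 3 := by positivity
  have hC₂S : 1 / C₂ ≤ S := by
    have h1 : 50 / S ^ 3 ≤ C₂ / 16 := by nlinarith [mul_nonneg hn0 hlog, mul_nonneg hn0 hc₁]
    have h2 : 1 / S ≤ 1 / S ^ 3 :=
      one_div_le_one_div_of_le (by positivity) (pow_le_of_le_one hS0.le hS1 (by norm_num))
    have h3 : 50 / S ^ 3 = 50 * (1 / S ^ 3) := by ring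
    have h4 : 0 < 1 / S := by positivity
    rw [one_div_le (by linarith) hS0]
    linarith
  refine ⟨2 * n * (2 * c₁ + Real.log C₂ + 1) + C₂ / 16 + 2 + 50 / S ^ 3, by positivity, ?_⟩
  intro m hm p' q hp' hq N₀ hN₀
  set M := C₂ * m with hM
  have hM1 : 1 ≤ M := by nlinarith
  set s₀ := Real.exp (-(2 * c₁ * m)) / M with hs₀
  have hs₀pos : 0 < s₀ := by positivity
  have hMs₀ : M * s₀ = Real.exp (-(2 * c₁ * m)) := by rw [hs₀]; field_simp
  have hs₀S : s₀ ≤ S := by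
    refine le_trans ?_ hC₂S
    rw [hs₀]
    refine div_le_div₀ (by norm_num) (Real.exp_le_one_iff.2 ?_) (by linarith) (by nlinarith)
    have := mul_nonneg hc₁ (by linarith : (0 : ℝ) ≤ m)
    linarith
  have hlogs : Real.log s₀ = -(2 * c₁ * m) - (Real.log C₂ + Real.log m) := by
    rw [hs₀, Real.log_div (Real.exp_pos _).ne' (by linarith), Real.log_exp, hM,
      Real.log_mul (by linarith) (by linarith)]
  have hlogm : Real.log m ≤ m := (Real.log_le_sub_one_of_pos (by linarith)).trans (by linarith)
  have hlogs' : -(2 * n * ((2 * c₁ + Real.log C₂ + 1) * m)) ≤ 2 * n * Real.log s₀ := by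
    rw [← mul_neg]
    refine mul_le_mul_of_nonneg_left ?_ hn0
    rw [hlogs]
    nlinarith
  set lam := C₀ * (2 * M + 9 * m) with hlam
  have hlam0 : 0 ≤ lam := by positivity
  set κ := -(2 * n * Real.log s₀) - M / 8 with hκ
  set L := gaussExp n (lam + 1) s₀ p' with hL
  have hcen : ∀ s ∈ Icc s₀ S, nsq (gaussCenter s₀ p' s) ≤ 4 * m := fun s hs =>
    (nsq_gaussCenter_le p' hs.1 (by linarith [hs.2])).trans (by linarith)
  have hregion : ∀ s ∈ Icc s₀ S, ∀ p, κ < L s p → nsq p < 2 * M + 8 * m := by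
    intro s hs p hlt
    have hspos : 0 < s := hs₀pos.trans_le hs.1
    have h1 := gaussExp_le (n := n) (lam + 1) s₀ p' p hspos (hs.2.trans hS1)
    have h2 : 2 * n * Real.log s₀ ≤ 2 * n * Real.log s :=
      mul_le_mul_of_nonneg_left (Real.log_le_log hs₀pos hs.1) hn0
    have h3 : nsq (p - gaussCenter s₀ p' s) / (8 * s) < M / 8 := by
      have : 0 ≤ (lam + 1) * s := by positivity
      rw [hL] at hlt
      linarith
    rw [div_lt_div_iff₀ (by positivity) (by norm_num)] at h3
    have h4 := nsq_add_le (p - gaussCenter s₀ p' s) (gaussCenter s₀ p' s)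
    rw [sub_add_cancel] at h4
    have h5 : M * s ≤ M * 1 := mul_le_mul_of_nonneg_left (hs.2.trans hS1) (by linarith)
    linarith [hcen s hs]
  have hcomp := subsolution_le (L := L) (L' := fun s p => kin (L s) p - (lam + 1)) (κ := κ)
    (N := Real.exp (N₀ + 2 * n * Real.log s₀)) (r := 2 * M + 8 * m) hu eu hlam0 (Real.exp_pos _)
    (continuousOn_gaussExp (lam + 1) s₀ p' hs₀pos)
    (fun s _ => contDiff_gaussExp (lam + 1) s₀ p' s)
    (fun s hs p => hasDerivAt_gaussExp (lam + 1) s₀ p' p (hs₀pos.trans_le hs.1).ne')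
    (fun s _ p => by linarith)
    (fun s hs p hlt => by
      refine le_trans (neg_le_neg ?_) (hlow p)
      exact mul_le_mul_of_nonneg_left (by linarith [hregion s hs p hlt]) hC₀)
    (fun s hs p hr => by
      by_contra! hlt
      linarith [hregion s hs p hlt])
    (fun p => by
      have hs₀1 : s₀ ≤ 1 := hs₀S.trans hS1
      have h1 := gaussExp_le (n := n) (lam + 1) s₀ p' p hs₀pos hs₀1
      have hc : gaussCenter s₀ p' s₀ = p' := by simp [gaussCenter]
      rw [hc, ← hL] at h1
      have hls : 0 ≤ (lam + 1) * s₀ := by positivity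
      by_cases hp : nsq (p - p') ≤ Real.exp (-(2 * c₁ * m))
      · have h2 : 0 ≤ nsq (p - p') / (8 * s₀) := div_nonneg (nsq_nonneg _) (by positivity)
        calc _ ≤ Real.exp (N₀ + 2 * n * Real.log s₀) * Real.exp (L s₀ p) :=
              mul_le_mul_of_nonneg_left (by linarith [Real.exp_pos κ]) (Real.exp_pos _).le
          _ = Real.exp (N₀ + 2 * n * Real.log s₀ + L s₀ p) := (Real.exp_add _ _).symm
          _ ≤ Real.exp (u p) := Real.exp_le_exp.2 (by linarith [hN₀ p hp])
      · push Not at hp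
        have h2 : M / 8 ≤ nsq (p - p') / (8 * s₀) := by
          rw [div_le_div_iff₀ (by norm_num) (by positivity)]
          linarith
        refine le_trans (mul_nonpos_of_nonneg_of_nonpos (Real.exp_pos _).le ?_) (Real.exp_pos _).le
        exact sub_nonpos.2 (Real.exp_le_exp.2 (by linarith)))
    (s := S) ⟨hs₀S, le_rfl⟩ q
  have hLq : -(M / 16) - m - 50 / S ^ 3 * m ≤ L S q := by
    have h1 := le_gaussExp (n := n) (lam + 1) s₀ p' q hS0 hS1
    rw [← hL] at h1
    have h2 : 5 * nsq (q - gaussCenter s₀ p' S) / S ^ 3 ≤ 50 / S ^ 3 * m := by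
      rw [div_mul_eq_mul_div]
      refine div_le_div_of_nonneg_right ?_ (by positivity)
      have := nsq_sub_le q (gaussCenter s₀ p' S)
      linarith [hcen S ⟨hs₀S, le_rfl⟩]
    have h3 : 2 * n * Real.log S ≤ 0 :=
      mul_nonpos_of_nonneg_of_nonpos hn0 (Real.log_nonpos hS0.le hS1)
    have h4 : (lam + 1) * S ≤ M / 16 + m := by
      rw [hS, mul_one_div, div_le_iff₀ (by positivity), hlam]
      nlinarith
    linarith
  have hκL : κ ≤ L S q - 1 := by
    have h1 : (2 + 50 / S ^ 3 + 2 * n * (2 * c₁ + 1) + 2 * n * Real.log C₂) * m ≤ C₂ / 16 * m :=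
      mul_le_mul_of_nonneg_right hC₂' (by linarith)
    rw [hκ]
    rw [hM] at hLq ⊢
    nlinarith
  have hfin : Real.exp (N₀ + 2 * n * Real.log s₀) * Real.exp (L S q - 1) ≤ Real.exp (u q) := by
    refine le_trans (mul_le_mul_of_nonneg_left ?_ (Real.exp_pos _).le) hcomp
    have h1 := Real.exp_le_exp.2 hκL
    have h2 : Real.exp (L S q) = Real.exp (L S q - 1) * Real.exp 1 := by
      rw [← Real.exp_add, sub_add_cancel]
    have h3 := Real.add_one_le_exp (1 : ℝ)
    rw [h2]
    nlinarith [Real.exp_pos (L S q - 1)]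
  rw [← Real.exp_add, Real.exp_le_exp] at hfin
  rw [hM] at hLq
  nlinarith

end HarnackChain

section QuadraticBounds

variable {n : ℕ}

/-- A linear functional is nonnegative on some translate of any centred ball. -/
lemma exists_half_ball (f : E n × E n →L[ℝ] ℝ) {r : ℝ} (hr : 0 ≤ r) :
    ∃ e : E n × E n, nsq e ≤ r ∧ ∀ y, nsq y ≤ r → 0 ≤ f (e + y) := by
  obtain ⟨e, he, hmax⟩ := (isCompact_nsq_le (n := n) r).exists_isMaxOn
    ⟨0, by simpa [nsq] using hr⟩ f.continuous.continuousOn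
  refine ⟨e, he, fun y hy => ?_⟩
  have : f (-y) ≤ f e := hmax (show nsq (-y) ≤ r by rwa [nsq_neg])
  rw [map_add]
  rw [map_neg] at this
  linarith

lemma kin_le_kin_of_min {φ ψ : E n × E n → ℝ} (hφ : ContDiff ℝ ∞ φ) (hψ : ContDiff ℝ ∞ ψ)
    {p : E n × E n} (hmin : ∀ q, φ p - ψ p ≤ φ q - ψ q) : kin ψ p ≤ kin φ p := by
  have h1 := kin_sub_kin hφ hψ p
  have h2 := lapV_nonneg_of_min (hφ.sub hψ) hmin
  have h3 : ∀ j, pd (fun q => φ q - ψ q) j p = 0 := pd_eq_zero_of_min hmin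
  simp only [h3, mul_zero, sub_zero, Finset.sum_const_zero, add_zero, ne_eq, OfNat.ofNat_ne_zero,
    not_false_eq_true, zero_pow] at h1
  linarith

lemma neg_le_inner (a b : E n) : -((‖a‖ ^ 2 + ‖b‖ ^ 2) / 2) ≤ inner ℝ a b := by
  have := @norm_add_sq_real _ _ _ a b
  nlinarith [sq_nonneg ‖a + b‖]

lemma exists_abs_le {u h : E n × E n → ℝ} (hu : ContDiff ℝ ∞ u) (eu : ∀ p, kin u p + h p = 0)
    {C₀ A a : ℝ} (hC₀ : 0 ≤ C₀) (hlow : ∀ p, -(C₀ * (1 + nsq p)) ≤ h p) (hA : 0 ≤ A) (ha : 0 ≤ a)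
    (hess : ∀ p z : E n × E n,
      -(A * Real.exp (a * nsq p) * nsq z) ≤ coords z ⬝ᵥ (Hess u p *ᵥ coords z)) :
    ∃ C : ℝ, 0 ≤ C ∧ ∀ p, |u p| ≤ C * (1 + nsq p) := by
  obtain ⟨C₁, hC₁, h₁⟩ := harnack_chain hu eu hC₀ hlow (le_refl 0)
  obtain ⟨C₂, hC₂, h₂⟩ := harnack_chain hu eu hC₀ hlow (show 0 ≤ 2 * a by linarith)
  obtain ⟨w, -, hw⟩ := (isCompact_nsq_le (n := n) 1).exists_isMinOn
    ⟨0, by simp [nsq]⟩ hu.continuous.continuousOn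
  have hn := nsq_nonneg (n := n)
  have hz : nsq (0 : E n × E n) = 0 := by simp [nsq]
  refine ⟨|u w| + |u 0| + 2 * A + C₁ + 2 * C₂, by positivity, fun p => abs_le.2 ⟨?_, ?_⟩⟩
  · have := h₁ (1 + nsq p) (by linarith [hn p]) 0 p (by linarith [hn p]) (by linarith) (u w)
      (fun q hq => hw (by simpa using hq))
    nlinarith [neg_abs_le (u w), abs_nonneg (u w), abs_nonneg (u 0), hn p,
      mul_nonneg (abs_nonneg (u w)) (hn p), mul_nonneg (abs_nonneg (u 0)) (hn p),
      mul_nonneg hA (hn p), mul_nonneg hC₂ (hn p)]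
  · set m := 2 * (1 + nsq p) with hm
    have hm1 : 1 ≤ m := by linarith [hn p]
    set r := Real.exp (-(2 * (2 * a) * m)) with hr
    have hr1 : r ≤ 1 := Real.exp_le_one_iff.2 (by
      have := mul_nonneg ha (by linarith : 0 ≤ m)
      linarith)
    obtain ⟨e, he, hball⟩ := exists_half_ball (fderiv ℝ u p) (Real.exp_pos (-(2 * (2 * a) * m))).le
    have hkey : ∀ q, nsq (q - (p + e)) ≤ r → u p - 2 * A ≤ u q := by
      intro q hq
      set y := q - (p + e) with hy
      have hq' : q = p + (e + y) := by rw [hy]; abel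
      have hz : nsq (e + y) ≤ 4 * r := by linarith [nsq_add_le e y]
      have htan := tangent_lower_bound hu p (e + y)
        (κ := A * Real.exp (4 * a * m) * (4 * r)) fun s hs => by
          refine le_trans (neg_le_neg ?_) (hess _ _)
          refine mul_le_mul ?_ hz (hn _) (by positivity)
          refine mul_le_mul_of_nonneg_left (Real.exp_le_exp.2 ?_) hA
          have h1 := nsq_add_le p (s • (e + y))
          rw [nsq_smul] at h1
          have h2 : s ^ 2 * nsq (e + y) ≤ 1 * 4 :=
            mul_le_mul (pow_le_one₀ hs.1 hs.2) (by linarith) (hn _) (by norm_num)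
          have h3 : nsq (p + s • (e + y)) ≤ 4 * m := by linarith [hn p]
          nlinarith
      have hexp : Real.exp (4 * a * m) * r = 1 := by
        rw [hr, ← Real.exp_add, Real.exp_eq_one_iff]
        ring
      have h1 := hball y hq
      rw [← hq'] at htan
      have h2 : A * Real.exp (4 * a * m) * (4 * r) = 4 * A := by
        linear_combination 4 * A * hexp
      linarith
    have hpe : nsq (p + e) ≤ m := by linarith [nsq_add_le p e]
    have := h₂ m hm1 (p + e) 0 hpe (by linarith) _ hkey
    nlinarith [le_abs_self (u 0), abs_nonneg (u w), abs_nonneg (u 0), hn p,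
      mul_nonneg (abs_nonneg (u w)) (hn p), mul_nonneg (abs_nonneg (u 0)) (hn p),
      mul_nonneg hA (hn p), mul_nonneg hC₁ (hn p)]

lemma exists_le_of_semiconvex {u h : E n × E n → ℝ} (hu : ContDiff ℝ ∞ u)
    (eu : ∀ p, kin u p + h p = 0) {C k : ℝ} (hC : 0 ≤ C) (hk : 0 ≤ k)
    (hu' : ∀ p, |u p| ≤ C * (1 + nsq p))
    (hh : ∀ p z, h p + fderiv ℝ h p z - k * nsq z ≤ h (p + z)) :
    ∃ C' : ℝ, 0 ≤ C' ∧ ∀ p, h p ≤ C' * (1 + nsq p) := by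
  have hn := nsq_nonneg (n := n)
  set K := 16 * C + 1 with hK
  have hK0 : 0 ≤ K := by positivity
  refine ⟨4 * k + 2 * n * K + 11 * K, by positivity, fun p => ?_⟩
  set m := 1 + nsq p with hm
  have hm1 : 1 ≤ m := by linarith [hn p]
  obtain ⟨e, he, hball⟩ := exists_half_ball (fderiv ℝ h p) (by linarith : 0 ≤ m)
  set c := p + e with hc
  have hcm : nsq c ≤ 4 * m := by linarith [nsq_add_le p e]
  set ψ := quad 0 (-K) 0 (-K) c with hψ
  have hψ' : ∀ w, ψ w = -(K * nsq (w - c)) := by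
    intro w
    simp only [hψ, quad, nsq, Prod.fst_sub, Prod.snd_sub]
    ring
  have hψc : ψ c = 0 := by rw [hψ']; simp [nsq]
  have hsψ : ContDiff ℝ ∞ ψ := contDiff_quad _ _ _ _ _
  have hcomp : IsCompact {w | nsq (w - c) ≤ m} := by
    have h1 := (isCompact_nsq_le (n := n) m).image (continuous_add_const c)
    convert h1 using 1
    ext w
    simp only [mem_ofPred_eq, mem_image]
    exact ⟨fun hw => ⟨w - c, hw, by abel⟩, by rintro ⟨y, hy, rfl⟩; simpa using hy⟩
  obtain ⟨w, hw, hmin⟩ := hcomp.exists_isMinOn ⟨c, by simp [nsq]; linarith [hn p]⟩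
    (hu.sub hsψ).continuous.continuousOn
  have hmin' : ∀ q, u w - ψ w ≤ u q - ψ q := by
    intro q
    rcases le_or_gt (nsq (q - c)) m with hq | hq
    · exact hmin hq
    · have h1 : u w - ψ w ≤ u c - ψ c := hmin (show nsq (c - c) ≤ m by simp [nsq]; linarith [hn p])
      have h2 := (abs_le.1 (hu' c)).2
      have h3 := (abs_le.1 (hu' q)).1
      have h4 := nsq_add_le (q - c) c
      rw [sub_add_cancel] at h4
      rw [hψc] at h1
      rw [hψ' q]
      have h5 : C * (1 + nsq c) ≤ C * (5 * m) := mul_le_mul_of_nonneg_left (by linarith) hC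
      have h6 : C * (1 + nsq q) ≤ C * (9 * m + 2 * nsq (q - c)) :=
        mul_le_mul_of_nonneg_left (by linarith) hC
      have h7 : (14 * C + 1) * m ≤ (14 * C + 1) * nsq (q - c) :=
        mul_le_mul_of_nonneg_left hq.le (by positivity)
      rw [hK]
      linarith
  have hkin := kin_le_kin_of_min hu hsψ hmin'
  rw [hψ, kin_quad] at hkin
  have hin := neg_le_inner w.2 (w.1 - c.1)
  have hw' : nsq (w - c) ≤ m := hw
  have hw2 : nsq w ≤ 10 * m := by
    have h4 := nsq_add_le (w - c) c
    rw [sub_add_cancel] at h4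
    linarith
  have ha1 : ‖w.2‖ ^ 2 ≤ 10 * m := by
    unfold nsq at hw2
    linarith [sq_nonneg ‖w.1‖]
  have ha2 : ‖w.1 - c.1‖ ^ 2 ≤ m := by
    have : nsq (w - c) = ‖w.1 - c.1‖ ^ 2 + ‖w.2 - c.2‖ ^ 2 := rfl
    linarith [sq_nonneg ‖w.2 - c.2‖]
  have h1 := hh p (e + (w - c))
  have h2 := hball (w - c) hw'
  have h3 : nsq (e + (w - c)) ≤ 4 * m := by linarith [nsq_add_le e (w - c)]
  rw [show p + (e + (w - c)) = w by rw [hc]; abel] at h1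
  have h4 : k * nsq (e + (w - c)) ≤ k * (4 * m) := mul_le_mul_of_nonneg_left h3 hk
  have h5 : 0 ≤ 4 * (-K) ^ 2 * ‖w.2 - c.2‖ ^ 2 := by positivity
  have h6 : -(K * (11 * m)) ≤ 2 * K * inner ℝ w.2 (w.1 - c.1) := by
    nlinarith
  have h7 : (2 : ℝ) * n * K ≤ 2 * n * K * m := le_mul_of_one_le_right (by positivity) hm1
  linarith [eu w]

end QuadraticBounds

section Comparison

variable {n : ℕ}

lemma kin_quad_zero_le {α M : ℝ} (hα : 0 ≤ α) (hM : α ≤ M) (p : E n × E n) :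
    kin (quad α α 0 α 0) p ≤ (2 * n * M + 4 * M ^ 2 + M) * (1 + nsq p) := by
  rw [kin_quad]
  have h1 := neg_le_inner p.2 p.1
  have h2 : ‖p.2‖ ^ 2 ≤ nsq p := by unfold nsq; linarith [sq_nonneg ‖p.1‖]
  have h3 : ‖p.2‖ ^ 2 + ‖p.1‖ ^ 2 = nsq p := by unfold nsq; ring
  have h4 : α ^ 2 ≤ M ^ 2 := pow_le_pow_left₀ hα hM 2
  have h5 : 4 * α ^ 2 * ‖p.2‖ ^ 2 ≤ 4 * M ^ 2 * nsq p := by gcongr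
  have h6 : 2 * n * α ≤ 2 * n * M := by gcongr
  have h7 : α * -(2 * inner ℝ p.2 p.1) ≤ M * nsq p :=
    (mul_le_mul_of_nonneg_left (by linarith) hα).trans
      (mul_le_mul_of_nonneg_right hM (nsq_nonneg p))
  have h8 : 0 ≤ 2 * n * M * nsq p :=
    mul_nonneg (mul_nonneg (by positivity) (hα.trans hM)) (nsq_nonneg p)
  simp only [Prod.fst_zero, Prod.snd_zero, sub_zero]
  nlinarith [sq_nonneg M]

/-- Comparison principle for subsolutions of quadratic growth. -/
lemma comparison_of_growth {h : E n × E n → ℝ} {L L' ℓ ℓ' : ℝ → E n × E n → ℝ} {t₀ t₁ A C : ℝ}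
    (hA : 0 ≤ A) (hC : 0 ≤ C) (hup : ∀ p, h p ≤ C * (1 + nsq p))
    (cL : ContinuousOn (fun q : ℝ × (E n × E n) => L q.1 q.2) (Icc t₀ t₁ ×ˢ univ))
    (cℓ : ContinuousOn (fun q : ℝ × (E n × E n) => ℓ q.1 q.2) (Icc t₀ t₁ ×ˢ univ))
    (sL : ∀ t ∈ Icc t₀ t₁, ContDiff ℝ ∞ (L t)) (sℓ : ∀ t ∈ Icc t₀ t₁, ContDiff ℝ ∞ (ℓ t))
    (dL : ∀ t ∈ Icc t₀ t₁, ∀ p, HasDerivAt (fun τ => L τ p) (L' t p) t)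
    (dℓ : ∀ t ∈ Icc t₀ t₁, ∀ p, HasDerivAt (fun τ => ℓ τ p) (ℓ' t p) t)
    (eL : ∀ t ∈ Icc t₀ t₁, ∀ p, kin (L t) p + h p ≤ L' t p)
    (eℓ : ∀ t ∈ Icc t₀ t₁, ∀ p, ℓ' t p = kin (ℓ t) p + h p)
    (hinit : ∀ p, ℓ t₀ p ≤ L t₀ p) (hgrow : ∀ t ∈ Icc t₀ t₁, ∀ p, ℓ t p ≤ A * (1 + nsq p))
    {t : ℝ} (ht : t ∈ Icc t₀ t₁) (p : E n × E n) : ℓ t p ≤ L t p := by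
  set α₀ := A + 1 with hα₀
  have hα₀1 : 1 ≤ α₀ := by linarith
  set K := 2 * n * (2 * α₀) + 4 * (2 * α₀) ^ 2 + 2 * α₀ + C + 1 with hK
  have hK0 : 0 < K := by positivity
  set δ := α₀ / K with hδ
  have hδ0 : 0 < δ := by positivity
  have hKδ : K * δ = α₀ := by rw [hδ]; field_simp
  have step : ∀ k : ℕ, ∀ t ∈ Icc t₀ t₁, t ≤ t₀ + k * δ → ∀ p, ℓ t p ≤ L t p := by
    intro k
    induction k with
    | zero =>
      intro t ht hle
      obtain rfl : t = t₀ := le_antisymm (by simpa using hle) ht.1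
      exact hinit
    | succ k ih =>
      intro t ht hle p
      rcases le_or_gt t (t₀ + k * δ) with hlt | hlt
      · exact ih t ht hlt p
      set a := t₀ + k * δ with ha
      have ha0 : t₀ ≤ a := by rw [ha]; linarith [show (0 : ℝ) ≤ k * δ by positivity]
      have hsub : Icc a t ⊆ Icc t₀ t₁ := Icc_subset_Icc ha0 ht.2
      have hsub' := prod_mono_left (t := (univ : Set (E n × E n))) hsub
      have hta : t - a ≤ δ := by rw [ha]; push_cast at hle; linarith
      have hαle : ∀ τ ∈ Icc a t, α₀ ≤ α₀ + K * (τ - a) ∧ α₀ + K * (τ - a) ≤ 2 * α₀ := by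
        intro τ hτ
        have h1 : 0 ≤ K * (τ - a) := mul_nonneg hK0.le (by linarith [hτ.1])
        have h2 : K * (τ - a) ≤ K * δ := mul_le_mul_of_nonneg_left (by linarith [hτ.2]) hK0.le
        exact ⟨by linarith, by linarith⟩
      have hβ : ∀ α : ℝ, ∀ p : E n × E n, quad α α 0 α 0 p = α * (1 + nsq p) := by
        intro α p
        simp only [quad, nsq, Prod.fst_zero, Prod.snd_zero, sub_zero]
        ring
      refine comparison_of_barrier (h := h)
        (β := fun τ => quad (α₀ + K * (τ - a)) (α₀ + K * (τ - a)) 0 (α₀ + K * (τ - a)) 0)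
        (β' := fun _ p => K * (1 + nsq p)) (cL.mono hsub') (cℓ.mono hsub')
        ?_ (fun τ hτ => sL τ (hsub hτ)) (fun τ hτ => sℓ τ (hsub hτ))
        (fun τ _ => contDiff_quad _ _ _ _ _) (fun τ hτ => dL τ (hsub hτ))
        (fun τ hτ => dℓ τ (hsub hτ)) ?_ (fun τ hτ => eL τ (hsub hτ)) (fun τ hτ => eℓ τ (hsub hτ))
        ?_ (ih a ⟨ha0, hlt.le.trans ht.2⟩ le_rfl) ?_ (right_mem_Icc.2 hlt.le) p
      · simp only [hβ]
        have := continuous_nsq (n := n)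
        exact Continuous.continuousOn (by fun_prop)
      · intro τ _ p
        simp only [hβ]
        exact (((((hasDerivAt_id τ).sub_const a).const_mul K).const_add α₀).mul_const
          (1 + nsq p)).congr_deriv (by simp)
      · intro τ hτ p
        have h1 := kin_quad_zero_le (n := n) (by linarith [(hαle τ hτ).1]) (hαle τ hτ).2 p
        have h2 := hup p
        have h3 : K * (1 + nsq p) = (2 * n * (2 * α₀) + 4 * (2 * α₀) ^ 2 + 2 * α₀) * (1 + nsq p)
          + C * (1 + nsq p) + (1 + nsq p) := by rw [hK]; ring
        linarith [nsq_nonneg p]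
      · refine fun B => ⟨B, fun τ hτ p hp => ?_⟩
        rw [hβ]
        have h1 := hgrow τ (hsub hτ) p
        have h2 : (A + 1) * (1 + nsq p) ≤ (α₀ + K * (τ - a)) * (1 + nsq p) :=
          mul_le_mul_of_nonneg_right (hαle τ hτ).1 (by linarith [nsq_nonneg p])
        linarith
  obtain ⟨k, hk⟩ := exists_nat_ge ((t - t₀) / δ)
  refine step k t ht ?_ p
  rw [div_le_iff₀ hδ0] at hk
  linarith

end Comparison

section Midpoint

variable {n : ℕ}

lemma hasDerivAt_along {ℓ : ℝ → E n × E n → ℝ} {c : ℝ → E n × E n} {c' : E n × E n} {t : ℝ}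
    (hℓ : DifferentiableAt ℝ (fun q : ℝ × (E n × E n) => ℓ q.1 q.2) (t, c t))
    (hc : HasDerivAt c c' t) :
    HasDerivAt (fun τ => ℓ τ (c τ))
      (deriv (fun τ => ℓ τ (c t)) t + fderiv ℝ (ℓ t) (c t) c') t := by
  obtain ⟨G, hG⟩ := hℓ
  have h1 := hG.comp_hasDerivAt t ((hasDerivAt_id t).prodMk hc)
  have h2 : HasDerivAt (fun τ => ℓ τ (c t)) (G (1, 0)) t :=
    HasFDerivAt.comp_hasDerivAt (f := fun τ => (τ, c t)) t hG
      ((hasDerivAt_id t).prodMk (hasDerivAt_const t (c t)))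
  have h3 : HasFDerivAt (ℓ t) (G.comp (.prod 0 (.id ℝ _))) (c t) :=
    HasFDerivAt.comp (f := fun p => (t, p)) (c t) hG
      ((hasFDerivAt_const t (c t)).prodMk (hasFDerivAt_id (c t)))
  refine HasDerivAt.congr_deriv (f := fun τ => ℓ τ (c τ)) h1 ?_
  rw [h2.deriv, h3.fderiv]
  simp [← map_add]

/-- Averaging a solution over `p ± z` produces a supersolution up to the cost of moving `z`. -/
lemma kin_average_le {φ h : E n × E n → ℝ} (hφ : ContDiff ℝ ∞ φ) {k₁ k₂ : ℝ}
    (hmid : ∀ p z, h p - (k₁ * ‖z.1‖ ^ 2 + k₂ * ‖z.2‖ ^ 2) / 2 ≤ (h (p + z) + h (p + -z)) / 2)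
    (p z : E n × E n) (w : E n) (c : ℝ) :
    kin (fun p => 1 / 2 * (φ (p + z) + φ (p + -z)) + c) p + h p
      ≤ 1 / 2 * ((kin φ (p + z) + h (p + z) + fderiv ℝ φ (p + z) (z.2, w))
          + (kin φ (p + -z) + h (p + -z) + fderiv ℝ φ (p + -z) (-(z.2, w))))
        + ((k₁ * ‖z.1‖ ^ 2 + k₂ * ‖z.2‖ ^ 2) / 2 + ‖w‖ ^ 2 / 4) := by
  have s1 : ∀ z : E n × E n, ContDiff ℝ ∞ fun p => φ (p + z) := fun z =>
    hφ.comp (contDiff_id.add contDiff_const)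
  have s2 : ContDiff ℝ ∞ fun p => φ (p + z) + φ (p + -z) := (s1 z).add (s1 (-z))
  have s3 : ContDiff ℝ ∞ fun p => 1 / 2 * (φ (p + z) + φ (p + -z)) := contDiff_const.mul s2
  have hsum : ∀ ζ : E n × E n, ∀ q, fderiv ℝ φ q ζ
      = (∑ i, ζ.1 i * pd φ (Sum.inl i) q) + ∑ i, ζ.2 i * pd φ (Sum.inr i) q := by
    intro ζ q
    rw [fderiv_apply_eq_sum, Fintype.sum_sum_type]
    rfl
  rw [map_neg, hsum, hsum, kin, kin, kin, lapV_add s3 contDiff_const, lapV_const,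
    lapV_const_mul s2, lapV_add (s1 z) (s1 (-z)), lapV_comp_add, lapV_comp_add]
  simp only [pd_add s3.diff (differentiable_const _), pd_const, pd_const_mul s2.diff,
    pd_add (s1 z).diff (s1 (-z)).diff, pd_comp_add, add_zero, EuclideanSpace.real_norm_sq_eq w,
    Prod.snd_add, Prod.snd_neg, PiLp.add_apply, PiLp.neg_apply]
  have hm := hmid p z
  set f := fun i => pd φ (Sum.inl i) (p + z)
  set f' := fun i => pd φ (Sum.inl i) (p + -z)
  set g := fun i => pd φ (Sum.inr i) (p + z)
  set g' := fun i => pd φ (Sum.inr i) (p + -z)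
  have key : (∑ i, (1 / 2 * (g i + g' i)) ^ 2) - ∑ i, p.2 i * (1 / 2 * (f i + f' i))
      ≤ 1 / 2 * (((∑ i, g i ^ 2) - ∑ i, (p.2 i + z.2 i) * f i)
          + ((∑ i, z.2 i * f i) + ∑ i, w i * g i)
          + (((∑ i, g' i ^ 2) - ∑ i, (p.2 i + -z.2 i) * f' i)
          - ((∑ i, z.2 i * f' i) + ∑ i, w i * g' i))) + (∑ i, w i ^ 2) / 4 := by
    simp only [Finset.mul_sum, Finset.sum_div, ← Finset.sum_sub_distrib, ← Finset.sum_add_distrib]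
    refine Finset.sum_le_sum fun i _ => ?_
    nlinarith [sq_nonneg (g i - g' i + w i)]
  linarith

/-- A path with cost `c` along which averages of solutions are supersolutions yields a midpoint
inequality. -/
lemma midpoint_inequality {h : E n × E n → ℝ} {ℓ : ℝ → E n × E n → ℝ} {T t₀ t₁ A C k₁ k₂ : ℝ}
    (h0 : 0 < t₀) (h01 : t₀ ≤ t₁) (h1 : t₁ < T)
    (hA : 0 ≤ A) (hC : 0 ≤ C) (hup : ∀ p, h p ≤ C * (1 + nsq p))
    (hℓ : ContDiffOn ℝ ∞ (fun q : ℝ × (E n × E n) => ℓ q.1 q.2) (Ioo 0 T ×ˢ univ))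
    (eℓ : ∀ t ∈ Ioo 0 T, ∀ p, deriv (fun τ => ℓ τ p) t = kin (ℓ t) p + h p)
    (hgrow : ∀ t ∈ Icc t₀ t₁, ∀ p, ℓ t p ≤ A * (1 + nsq p))
    (hmid : ∀ p z, h p - (k₁ * ‖z.1‖ ^ 2 + k₂ * ‖z.2‖ ^ 2) / 2 ≤ (h (p + z) + h (p + -z)) / 2)
    {z : ℝ → E n × E n} {w : ℝ → E n} {c : ℝ → ℝ}
    (hz : ∀ t, HasDerivAt z ((z t).2, w t) t) (hz0 : z t₀ = 0)
    (hc : ∀ t, HasDerivAt c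
      ((k₁ * ‖(z t).1‖ ^ 2 + k₂ * ‖(z t).2‖ ^ 2) / 2 + ‖w t‖ ^ 2 / 4) t) (hc0 : c t₀ = 0)
    (p : E n × E n) :
    ℓ t₁ p ≤ 1 / 2 * (ℓ t₁ (p + z t₁) + ℓ t₁ (p + -z t₁)) + c t₁ := by
  have hsub : Icc t₀ t₁ ⊆ Ioo 0 T := fun t ht => ⟨h0.trans_le ht.1, ht.2.trans_lt h1⟩
  have hopen : IsOpen (Ioo 0 T ×ˢ (univ : Set (E n × E n))) := isOpen_Ioo.prod isOpen_univ
  have hat : ∀ t ∈ Ioo 0 T, ∀ p,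
      ContDiffAt ℝ ∞ (fun q : ℝ × (E n × E n) => ℓ q.1 q.2) (t, p) := fun t ht p =>
    hℓ.contDiffAt (hopen.mem_nhds ⟨ht, mem_univ _⟩)
  have hdiff : ∀ t ∈ Ioo 0 T, ∀ p,
      DifferentiableAt ℝ (fun q : ℝ × (E n × E n) => ℓ q.1 q.2) (t, p) := fun t ht p =>
    (hat t ht p).differentiableAt (by simp)
  have sℓ : ∀ t ∈ Ioo 0 T, ContDiff ℝ ∞ (ℓ t) := fun t ht =>
    contDiff_iff_contDiffAt.2 fun p => (hat t ht p).comp p (contDiffAt_const.prodMk contDiffAt_id)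
  have hzc : Continuous z := continuous_iff_continuousAt.2 fun t => (hz t).continuousAt
  have hcc : Continuous c := continuous_iff_continuousAt.2 fun t => (hc t).continuousAt
  have cℓ : ContinuousOn (fun q : ℝ × (E n × E n) => ℓ q.1 q.2) (Icc t₀ t₁ ×ˢ univ) :=
    hℓ.continuousOn.mono (prod_mono_left hsub)
  have cavg : ∀ ζ : ℝ → E n × E n, Continuous ζ →
      ContinuousOn (fun q : ℝ × (E n × E n) => ℓ q.1 (q.2 + ζ q.1)) (Icc t₀ t₁ ×ˢ univ) :=
    fun ζ hζ => cℓ.comp (f := fun q : ℝ × (E n × E n) => (q.1, q.2 + ζ q.1))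
      (by fun_prop) fun q hq => ⟨hq.1, mem_univ _⟩
  refine comparison_of_growth (L := fun t p => 1 / 2 * (ℓ t (p + z t) + ℓ t (p + -z t)) + c t)
    (L' := fun t p => 1 / 2 * ((kin (ℓ t) (p + z t) + h (p + z t)
          + fderiv ℝ (ℓ t) (p + z t) ((z t).2, w t))
        + (kin (ℓ t) (p + -z t) + h (p + -z t) + fderiv ℝ (ℓ t) (p + -z t) (-((z t).2, w t))))
      + ((k₁ * ‖(z t).1‖ ^ 2 + k₂ * ‖(z t).2‖ ^ 2) / 2 + ‖w t‖ ^ 2 / 4))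
    (ℓ' := fun t p => kin (ℓ t) p + h p) hA hC hup ?_ cℓ ?_ (fun t ht => sℓ t (hsub ht)) ?_ ?_
    (fun t ht p => kin_average_le (sℓ t (hsub ht)) hmid p (z t) (w t) (c t))
    (fun t _ p => rfl) ?_ hgrow (right_mem_Icc.2 h01) p
  · exact (continuousOn_const.mul ((cavg z hzc).add (cavg (fun t => -z t) hzc.neg))).add
      (by fun_prop)
  · intro t ht
    have s1 : ∀ ζ : E n × E n, ContDiff ℝ ∞ fun p => ℓ t (p + ζ) := fun ζ =>
      (sℓ t (hsub ht)).comp (contDiff_id.add contDiff_const)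
    exact (contDiff_const.mul ((s1 _).add (s1 _))).add contDiff_const
  · intro t ht p
    have d1 := hasDerivAt_along (hdiff t (hsub ht) (p + z t)) ((hz t).const_add p)
    have d2 := hasDerivAt_along (hdiff t (hsub ht) (p + -z t)) ((hz t).neg.const_add p)
    rw [eℓ t (hsub ht)] at d1 d2
    exact ((d1.add d2).const_mul (1 / 2)).add (hc t)
  · intro t ht p
    have := ((hdiff t (hsub ht) p).comp t (f := fun τ => (τ, p))
      (differentiableAt_id.prodMk (differentiableAt_const p))).hasDerivAt
    exact this.congr_deriv (eℓ t (hsub ht) p)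
  · intro p
    simp only [hz0, hc0, neg_zero, add_zero]
    linarith

end Midpoint

section OptimalPath

variable {n : ℕ}

/-- The cost of a path solving the fourth-order Euler-Lagrange equation is a boundary term. -/
lemma hasDerivAt_cost {k₁ k₂ : ℝ} {y₀ y₁ y₂ y₃ : ℝ → E n} {t : ℝ}
    (h₀ : HasDerivAt y₀ (y₁ t) t) (h₁ : HasDerivAt y₁ (y₂ t) t) (h₂ : HasDerivAt y₂ (y₃ t) t)
    (h₃ : HasDerivAt y₃ ((2 * k₂) • y₂ t - (2 * k₁) • y₀ t) t) :
    HasDerivAt (fun t => 1 / 4 * inner ℝ (y₂ t) (y₁ t) - 1 / 4 * inner ℝ (y₃ t) (y₀ t)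
        + k₂ / 2 * inner ℝ (y₀ t) (y₁ t))
      ((k₁ * ‖y₀ t‖ ^ 2 + k₂ * ‖y₁ t‖ ^ 2) / 2 + ‖y₂ t‖ ^ 2 / 4) t := by
  refine (((h₂.inner ℝ h₁).const_mul (1 / 4)).sub ((h₃.inner ℝ h₀).const_mul (1 / 4))).add
    ((h₀.inner ℝ h₁).const_mul (k₂ / 2)) |>.congr_deriv ?_
  simp only [inner_sub_left, inner_smul_left, real_inner_self_eq_norm_sq, conj_trivial]
  rw [real_inner_comm (y₂ t) (y₀ t)]
  ring

section Scalar

variable (a b : ℝ)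

/-- A solution `sinh(at) sin(bt)` of the fourth-order Euler-Lagrange equation. -/
def pathF (t : ℝ) : ℝ := Real.sinh (a * t) * Real.sin (b * t)

/-- The first derivative of `pathF`. -/
def pathF₁ (t : ℝ) : ℝ :=
  a * (Real.cosh (a * t) * Real.sin (b * t)) + b * (Real.sinh (a * t) * Real.cos (b * t))

/-- The second derivative of `pathF`. -/
def pathF₂ (t : ℝ) : ℝ :=
  (a ^ 2 - b ^ 2) * pathF a b t + 2 * a * b * (Real.cosh (a * t) * Real.cos (b * t))

/-- The third derivative of `pathF`. -/
def pathF₃ (t : ℝ) : ℝ := (a ^ 2 - b ^ 2) * pathF₁ a b t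
  + 2 * a * b * (a * (Real.sinh (a * t) * Real.cos (b * t))
    - b * (Real.cosh (a * t) * Real.sin (b * t)))

/-- A primitive of `(a²+b²) * pathF`. -/
def pathG (t : ℝ) : ℝ :=
  a * (Real.cosh (a * t) * Real.sin (b * t)) - b * (Real.sinh (a * t) * Real.cos (b * t))

lemma hasDerivAt_sinh_const_mul (t : ℝ) :
    HasDerivAt (fun t => Real.sinh (a * t)) (a * Real.cosh (a * t)) t :=
  ((hasDerivAt_id t).const_mul a).sinh.congr_deriv (by simp [mul_comm])

lemma hasDerivAt_cosh_const_mul (t : ℝ) :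
    HasDerivAt (fun t => Real.cosh (a * t)) (a * Real.sinh (a * t)) t :=
  ((hasDerivAt_id t).const_mul a).cosh.congr_deriv (by simp [mul_comm])

lemma hasDerivAt_sin_const_mul (t : ℝ) :
    HasDerivAt (fun t => Real.sin (b * t)) (b * Real.cos (b * t)) t :=
  ((hasDerivAt_id t).const_mul b).sin.congr_deriv (by simp [mul_comm])

lemma hasDerivAt_cos_const_mul (t : ℝ) :
    HasDerivAt (fun t => Real.cos (b * t)) (-(b * Real.sin (b * t))) t :=
  ((hasDerivAt_id t).const_mul b).cos.congr_deriv (by simp [mul_comm])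

lemma hasDerivAt_pathF (t : ℝ) : HasDerivAt (pathF a b) (pathF₁ a b t) t :=
  ((hasDerivAt_sinh_const_mul a t).mul (hasDerivAt_sin_const_mul b t)).congr_deriv
    (by simp only [pathF₁]; ring)

lemma hasDerivAt_pathF₁ (t : ℝ) : HasDerivAt (pathF₁ a b) (pathF₂ a b t) t :=
  ((((hasDerivAt_cosh_const_mul a t).mul (hasDerivAt_sin_const_mul b t)).const_mul a).add
    (((hasDerivAt_sinh_const_mul a t).mul (hasDerivAt_cos_const_mul b t)).const_mul b)).congr_deriv
    (by simp only [pathF₂, pathF]; ring)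

lemma hasDerivAt_pathF₂ (t : ℝ) : HasDerivAt (pathF₂ a b) (pathF₃ a b t) t :=
  (((hasDerivAt_pathF a b t).const_mul (a ^ 2 - b ^ 2)).add
    (((hasDerivAt_cosh_const_mul a t).mul (hasDerivAt_cos_const_mul b t)).const_mul
      (2 * a * b))).congr_deriv (by simp only [pathF₃, pathF₁]; ring)

lemma hasDerivAt_pathF₃ (t : ℝ) : HasDerivAt (pathF₃ a b)
    (2 * (a ^ 2 - b ^ 2) * pathF₂ a b t - (a ^ 2 + b ^ 2) ^ 2 * pathF a b t) t :=
  (((hasDerivAt_pathF₁ a b t).const_mul (a ^ 2 - b ^ 2)).add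
    (((((hasDerivAt_sinh_const_mul a t).mul (hasDerivAt_cos_const_mul b t)).const_mul a).sub
      (((hasDerivAt_cosh_const_mul a t).mul (hasDerivAt_sin_const_mul b t)).const_mul b)).const_mul
        (2 * a * b))).congr_deriv (by simp only [pathF₂, pathF]; ring)

lemma hasDerivAt_pathG (t : ℝ) : HasDerivAt (pathG a b) ((a ^ 2 + b ^ 2) * pathF a b t) t :=
  ((((hasDerivAt_cosh_const_mul a t).mul (hasDerivAt_sin_const_mul b t)).const_mul a).sub
    (((hasDerivAt_sinh_const_mul a t).mul (hasDerivAt_cos_const_mul b t)).const_mul b)).congr_deriv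
    (by simp only [pathF]; ring)

lemma pathF₃_eq (t : ℝ) : pathF₃ a b t
    = 2 * (a ^ 2 - b ^ 2) * pathF₁ a b t - (a ^ 2 + b ^ 2) * pathG a b t := by
  simp only [pathF₃, pathF₁, pathG]
  ring

/-- The Wronskian of `pathF` and `pathG`. -/
def pathW (t : ℝ) : ℝ := b ^ 2 * Real.sinh (a * t) ^ 2 - a ^ 2 * Real.sin (b * t) ^ 2

lemma pathW_eq (t : ℝ) : pathW a b t
    = (a ^ 2 + b ^ 2) * pathF a b t ^ 2 - pathG a b t * pathF₁ a b t := by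
  have h1 := Real.cosh_sq (a * t)
  have h2 := Real.sin_sq_add_cos_sq (b * t)
  simp only [pathW, pathF, pathF₁, pathG]
  grind

lemma pathG_mul_pathF₂ (t : ℝ) :
    (a ^ 2 + b ^ 2) * pathF a b t * pathF₁ a b t - pathG a b t * pathF₂ a b t
      = 2 * a * b * (b * (Real.sinh (a * t) * Real.cosh (a * t))
        - a * (Real.sin (b * t) * Real.cos (b * t))) := by
  have h1 := Real.cosh_sq (a * t)
  have h2 := Real.sin_sq_add_cos_sq (b * t)
  simp only [pathF, pathF₁, pathF₂, pathG]
  grind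

lemma pathF_mul_pathF₃ (t : ℝ) :
    pathF a b t * pathF₃ a b t - pathF₁ a b t * pathF₂ a b t
      = -(2 * a * b * (a * (Real.sin (b * t) * Real.cos (b * t))
        + b * (Real.cosh (a * t) * Real.sinh (a * t)))) := by
  have h1 := Real.cosh_sq (a * t)
  have h2 := Real.sin_sq_add_cos_sq (b * t)
  simp only [pathF, pathF₁, pathF₂, pathF₃]
  grind

lemma pathG_mul_pathF₃ (t : ℝ) :
    pathG a b t * pathF₃ a b t - (a ^ 2 + b ^ 2) * pathF₁ a b t ^ 2
        + 2 * (a ^ 2 - b ^ 2) * pathW a b t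
      = -(2 * (a ^ 2 + b ^ 2) * (a ^ 2 * Real.sin (b * t) ^ 2
        + b ^ 2 * Real.sinh (a * t) ^ 2)) := by
  have h1 := Real.cosh_sq (a * t)
  have h2 := Real.sin_sq_add_cos_sq (b * t)
  simp only [pathF₁, pathF₃, pathG, pathW]
  grind

end Scalar

lemma exists_path_of_pathW_ne_zero {a b k₁ k₂ s : ℝ} (hk₁ : (a ^ 2 + b ^ 2) ^ 2 = 2 * k₁)
    (hk₂ : a ^ 2 - b ^ 2 = k₂) (hW : pathW a b s ≠ 0) (ζ : E n × E n) :
    ∃ (z : ℝ → E n × E n) (w : ℝ → E n) (c : ℝ → ℝ),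
      (∀ t, HasDerivAt z ((z t).2, w t) t) ∧ z 0 = 0 ∧ z s = ζ ∧
      (∀ t, HasDerivAt c ((k₁ * ‖(z t).1‖ ^ 2 + k₂ * ‖(z t).2‖ ^ 2) / 2 + ‖w t‖ ^ 2 / 4) t) ∧
      c 0 = 0 ∧
      2 * c s = ((a ^ 2 + b ^ 2) * (a * b * (a * (Real.sin (b * s) * Real.cos (b * s))
            + b * (Real.cosh (a * s) * Real.sinh (a * s)))) / pathW a b s) * ‖ζ.1‖ ^ 2
        - (((a ^ 2 + b ^ 2) * (a ^ 2 * Real.sin (b * s) ^ 2 + b ^ 2 * Real.sinh (a * s) ^ 2))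
            / pathW a b s) * inner ℝ ζ.1 ζ.2
        + (a * b * (b * (Real.sinh (a * s) * Real.cosh (a * s))
            - a * (Real.sin (b * s) * Real.cos (b * s))) / pathW a b s) * ‖ζ.2‖ ^ 2 := by
  set m := a ^ 2 + b ^ 2 with hm
  set W := pathW a b s with hWdef
  have eW := pathW_eq a b s
  rw [← hm, ← hWdef] at eW
  set α : E n := (m * pathF a b s / W) • ζ.1 - (pathG a b s / W) • ζ.2 with hα
  set β : E n := (pathF a b s / W) • ζ.2 - (pathF₁ a b s / W) • ζ.1 with hβ
  set y₀ : ℝ → E n := fun t => pathF a b t • α + pathG a b t • β with hy₀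
  set y₁ : ℝ → E n := fun t => pathF₁ a b t • α + (m * pathF a b t) • β with hy₁
  set y₂ : ℝ → E n := fun t => pathF₂ a b t • α + (m * pathF₁ a b t) • β with hy₂
  set y₃ : ℝ → E n := fun t => pathF₃ a b t • α + (m * pathF₂ a b t) • β with hy₃
  have d₀ : ∀ t, HasDerivAt y₀ (y₁ t) t := fun t =>
    ((hasDerivAt_pathF a b t).smul_const α).add ((hasDerivAt_pathG a b t).smul_const β)
  have d₁ : ∀ t, HasDerivAt y₁ (y₂ t) t := fun t =>
    ((hasDerivAt_pathF₁ a b t).smul_const α).add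
      (((hasDerivAt_pathF a b t).const_mul m).smul_const β)
  have d₂ : ∀ t, HasDerivAt y₂ (y₃ t) t := fun t =>
    ((hasDerivAt_pathF₂ a b t).smul_const α).add
      (((hasDerivAt_pathF₁ a b t).const_mul m).smul_const β)
  have d₃ : ∀ t, HasDerivAt y₃ ((2 * k₂) • y₂ t - (2 * k₁) • y₀ t) t := fun t => by
    refine (((hasDerivAt_pathF₃ a b t).smul_const α).add
      (((hasDerivAt_pathF₂ a b t).const_mul m).smul_const β)).congr_deriv ?_
    rw [pathF₃_eq, ← hm, hk₂, ← hk₁]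
    simp only [hy₂, hy₀]
    module
  have e₀ : y₀ s = ζ.1 := by
    have h1 : y₀ s = ((m * pathF a b s ^ 2 - pathG a b s * pathF₁ a b s) / W) • ζ.1 := by
      simp only [hy₀, hα, hβ]
      module
    rw [h1, ← eW, div_self hW, one_smul]
  have e₁ : y₁ s = ζ.2 := by
    have h1 : y₁ s = ((m * pathF a b s ^ 2 - pathG a b s * pathF₁ a b s) / W) • ζ.2 := by
      simp only [hy₁, hα, hβ]
      module
    rw [h1, ← eW, div_self hW, one_smul]
  have dc := fun t => hasDerivAt_cost (y₀ := y₀) (y₁ := y₁) (y₂ := y₂) (y₃ := y₃) (k₁ := k₁)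
    (k₂ := k₂) (d₀ t) (d₁ t) (d₂ t) (d₃ t)
  refine ⟨fun t => (y₀ t, y₁ t), y₂,
    fun t => 1 / 4 * inner ℝ (y₂ t) (y₁ t) - 1 / 4 * inner ℝ (y₃ t) (y₀ t)
      + k₂ / 2 * inner ℝ (y₀ t) (y₁ t), fun t => (d₀ t).prodMk (d₁ t), ?_, Prod.ext e₀ e₁,
    dc, ?_, ?_⟩
  · simp [hy₀, hy₁, pathF, pathF₁, pathG]
  · simp [hy₀, hy₁, pathF, pathF₁, pathG]
  · simp only [e₀, e₁]
    have e₂ : y₂ s = ((m * (pathF a b s * pathF₂ a b s - pathF₁ a b s ^ 2)) / W) • ζ.1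
        + ((m * pathF a b s * pathF₁ a b s - pathG a b s * pathF₂ a b s) / W) • ζ.2 := by
      simp only [hy₂, hα, hβ]
      module
    have e₃ : y₃ s = (m * (pathF a b s * pathF₃ a b s - pathF₁ a b s * pathF₂ a b s) / W) • ζ.1
        + ((m * pathF a b s * pathF₂ a b s - pathG a b s * pathF₃ a b s) / W) • ζ.2 := by
      simp only [hy₃, hα, hβ]
      module
    rw [e₂, e₃]
    simp only [inner_add_left, inner_smul_left, real_inner_self_eq_norm_sq, conj_trivial]
    rw [real_inner_comm ζ.1 ζ.2, pathF_mul_pathF₃, hm, pathG_mul_pathF₂, ← hm]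
    have h3 := pathG_mul_pathF₃ a b s
    rw [← hm, ← hWdef, hk₂] at h3
    have h4 : pathG a b s * pathF₃ a b s = m * pathF₁ a b s ^ 2 - 2 * k₂ * W
        - 2 * m * (a ^ 2 * Real.sin (b * s) ^ 2 + b ^ 2 * Real.sinh (a * s) ^ 2) := by
      linarith
    rw [h4]
    field_simp
    ring

lemma mu_facts {k₁ k₂ : ℝ} (hk₂ : 0 ≤ k₂) (hk : k₂ ^ 2 < 2 * k₁) :
    (mu1 k₁ k₂ / √2) ^ 2 + (mu2 k₁ k₂ / √2) ^ 2 = √(2 * k₁) ∧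
      (mu1 k₁ k₂ / √2) ^ 2 - (mu2 k₁ k₂ / √2) ^ 2 = k₂ := by
  have h : k₂ ≤ √(2 * k₁) := Real.le_sqrt_of_sq_le hk.le
  have h1 : 0 ≤ √(2 * k₁) + k₂ := by linarith
  have h2 : 0 ≤ √(2 * k₁) - k₂ := by linarith
  rw [div_pow, div_pow, mu1, mu2, Real.sq_sqrt h1, Real.sq_sqrt h2, Real.sq_sqrt zero_le_two]
  constructor <;> ring

/-- The time derivative of `s0C`. -/
lemma hasDerivAt_s0C (k₁ k₂ t : ℝ) : HasDerivAt (s0C k₁ k₂)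
    (2 * (mu1 k₁ k₂ / √2) * mu2 k₁ k₂ *
      (mu2 k₁ k₂ * (Real.sinh (mu1 k₁ k₂ / √2 * t) * Real.cosh (mu1 k₁ k₂ / √2 * t))
        - mu1 k₁ k₂ * (Real.sin (mu2 k₁ k₂ / √2 * t) * Real.cos (mu2 k₁ k₂ / √2 * t)))) t := by
  refine ((((hasDerivAt_sinh_const_mul (mu1 k₁ k₂ / √2) t).pow 2).const_mul (mu2 k₁ k₂ ^ 2)).sub
    (((hasDerivAt_sin_const_mul (mu2 k₁ k₂ / √2) t).pow 2).const_mul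
      (mu1 k₁ k₂ ^ 2))).congr_deriv ?_
  field_simp
  ring

lemma exists_path {k₁ k₂ : ℝ} (hk₁ : 0 ≤ k₁) (hk₂ : 0 ≤ k₂) (hk : k₂ ^ 2 < 2 * k₁) {s : ℝ}
    (hs : s0C k₁ k₂ s ≠ 0) (ζ : E n × E n) :
    ∃ (z : ℝ → E n × E n) (w : ℝ → E n) (c : ℝ → ℝ),
      (∀ t, HasDerivAt z ((z t).2, w t) t) ∧ z 0 = 0 ∧ z s = ζ ∧
      (∀ t, HasDerivAt c ((k₁ * ‖(z t).1‖ ^ 2 + k₂ * ‖(z t).2‖ ^ 2) / 2 + ‖w t‖ ^ 2 / 4) t) ∧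
      c 0 = 0 ∧
      2 * c s = 1 / 2 * (s1C k₁ k₂ s / s0C k₁ k₂ s * ‖ζ.1‖ ^ 2
        - 2 * (s2C k₁ k₂ s / s0C k₁ k₂ s) * inner ℝ ζ.1 ζ.2
        + deriv (s0C k₁ k₂) s / s0C k₁ k₂ s * ‖ζ.2‖ ^ 2) := by
  obtain ⟨hadd, hsub⟩ := mu_facts hk₂ hk
  have h2 : √2 ^ 2 = 2 := Real.sq_sqrt (by norm_num)
  set a := mu1 k₁ k₂ / √2 with ha
  set b := mu2 k₁ k₂ / √2 with hb
  have ha' : mu1 k₁ k₂ = √2 * a := by rw [ha]; field_simp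
  have hb' : mu2 k₁ k₂ = √2 * b := by rw [hb]; field_simp
  have hW : s0C k₁ k₂ s = 2 * pathW a b s := by
    rw [s0C, pathW, ← ha, ← hb, ha', hb', mul_pow, mul_pow, h2]
    ring
  have hW0 : pathW a b s ≠ 0 := fun h => hs (by rw [hW, h, mul_zero])
  obtain ⟨z, w, c, hz, hz0, hzs, hc, hc0, hcs⟩ := exists_path_of_pathW_ne_zero (k₁ := k₁)
    (by rw [hadd, Real.sq_sqrt (by linarith)]) hsub hW0 ζ
  refine ⟨z, w, c, hz, hz0, hzs, hc, hc0, hcs.trans ?_⟩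
  have hs1 : s1C k₁ k₂ s = 4 * ((a ^ 2 + b ^ 2) * (a * b *
      (a * (Real.sin (b * s) * Real.cos (b * s))
        + b * (Real.cosh (a * s) * Real.sinh (a * s))))) := by
    rw [s1C, ← ha, ← hb, ha', hb', hadd, Real.sqrt_mul (by norm_num)]
    linear_combination (2 * √k₁ * √2 * a * b * (a * Real.sin (b * s) * Real.cos (b * s)
      + b * Real.cosh (a * s) * Real.sinh (a * s))) * h2
  have hs2 : s2C k₁ k₂ s = 2 * ((a ^ 2 + b ^ 2) *
      (a ^ 2 * Real.sin (b * s) ^ 2 + b ^ 2 * Real.sinh (a * s) ^ 2)) := by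
    rw [s2C, ← ha, ← hb, ha', hb', ← hadd, mul_pow, mul_pow, h2]
    ring
  have hs0 : deriv (s0C k₁ k₂) s = 4 * (a * b * (b * (Real.sinh (a * s) * Real.cosh (a * s))
      - a * (Real.sin (b * s) * Real.cos (b * s)))) := by
    rw [(hasDerivAt_s0C k₁ k₂ s).deriv, ← ha, ← hb, ha', hb']
    linear_combination (2 * a * b * (b * (Real.sinh (a * s) * Real.cosh (a * s))
      - a * (Real.sin (b * s) * Real.cos (b * s)))) * h2
  rw [hs1, hs2, hs0, hW]
  field_simp
  ring

end OptimalPath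

section Forms

variable {n : ℕ}

lemma coords_neg (z : E n × E n) : coords (-z) = -coords z := by
  ext j
  rcases j with j | j <;> simp [coords]

lemma coords_dotProduct_self (z : E n × E n) : coords z ⬝ᵥ coords z = nsq z := by
  rw [← sum_coords_sq]
  simp only [dotProduct, sq]

lemma coords_dotProduct_fromBlocks (a b c d : ℝ) (z : E n × E n) :
    coords z ⬝ᵥ (Matrix.fromBlocks (a • 1) (b • 1) (c • 1) (d • 1) *ᵥ coords z)
      = a * ‖z.1‖ ^ 2 + (b + c) * inner ℝ z.1 z.2 + d * ‖z.2‖ ^ 2 := by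
  rw [coords, Matrix.fromBlocks_mulVec, Sum.elim_comp_inl, Sum.elim_comp_inr,
    sumElim_dotProduct_sumElim]
  simp only [Matrix.smul_mulVec, Matrix.one_mulVec, dotProduct_add, dotProduct_smul, smul_eq_mul]
  have h1 : ∀ x y : E n, x ⬝ᵥ y = inner ℝ x y := fun x y => by
    simp [dotProduct, PiLp.inner_apply, mul_comm]
  rw [h1, h1, h1, h1, real_inner_self_eq_norm_sq, real_inner_self_eq_norm_sq,
    real_inner_comm z.1 z.2]
  ring

lemma hess_isHermitian {φ : E n × E n → ℝ} (hφ : ContDiff ℝ ∞ φ) (p : E n × E n) :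
    (Hess φ p).IsHermitian := by
  have hd : Differentiable ℝ (fderiv ℝ φ) :=
    (hφ.fderiv_right (m := ∞) (by simp)).differentiable (by simp)
  have key : ∀ i j, pd (pd φ j) i p
      = fderiv ℝ (fderiv ℝ φ) p (_root_.stdBasis n i) (_root_.stdBasis n j) := by
    intro i j
    have : HasFDerivAt (pd φ j) _ p :=
      (hd p).hasFDerivAt.clm_apply (hasFDerivAt_const (_root_.stdBasis n j) p)
    rw [pd, this.fderiv]
    simp
  ext i j
  simp only [Hess, Matrix.conjTranspose_apply, of_apply, star_trivial, key]
  exact (hφ.contDiffAt.isSymmSndFDerivAt (by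
    rw [minSmoothness_of_isRCLikeNormedField]
    exact WithTop.coe_le_coe.2 (le_top : (2 : ℕ∞) ≤ ⊤))).eq _ _

lemma hess_add {φ ψ : E n × E n → ℝ} (hφ : ContDiff ℝ ∞ φ) (hψ : ContDiff ℝ ∞ ψ)
    (p : E n × E n) : Hess (fun q => φ q + ψ q) p = Hess φ p + Hess ψ p := by
  ext i j
  simp only [Hess, of_apply, Matrix.add_apply, pd_add hφ.diff hψ.diff,
    pd_add (contDiff_pd hφ _).diff (contDiff_pd hψ _).diff]

lemma hess_const_mul {φ : E n × E n → ℝ} (hφ : ContDiff ℝ ∞ φ) (c : ℝ) (p : E n × E n) :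
    Hess (fun q => c * φ q) p = c • Hess φ p := by
  ext i j
  simp only [Hess, of_apply, Matrix.smul_apply, smul_eq_mul, pd_const_mul hφ.diff,
    pd_const_mul (contDiff_pd hφ _).diff]

lemma coords_dotProduct_nonneg {M : Matrix (Fin n ⊕ Fin n) (Fin n ⊕ Fin n) ℝ} (hM : M.PosSemidef)
    (z : E n × E n) : 0 ≤ coords z ⬝ᵥ (M *ᵥ coords z) := by
  simpa using hM.dotProduct_mulVec_nonneg (coords z)

lemma posSemidef_of_coords {M : Matrix (Fin n ⊕ Fin n) (Fin n ⊕ Fin n) ℝ} (hM : M.IsHermitian)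
    (h : ∀ z : E n × E n, 0 ≤ coords z ⬝ᵥ (M *ᵥ coords z)) : M.PosSemidef := by
  refine Matrix.PosSemidef.of_dotProduct_mulVec_nonneg hM fun x => ?_
  have hx : coords ((WithLp.toLp 2 (x ∘ Sum.inl), WithLp.toLp 2 (x ∘ Sum.inr)) : E n × E n) = x := by
    ext j
    rcases j with j | j <;> simp [coords]
  have := h (WithLp.toLp 2 (x ∘ Sum.inl), WithLp.toLp 2 (x ∘ Sum.inr))
  rw [hx] at this
  simpa using this

lemma contDiff_hfun {U : E n × E n → ℝ} (hU : ContDiff ℝ ∞ U) : ContDiff ℝ ∞ (hfun U) := by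
  unfold hfun
  have h2 : ∀ i : Fin n, ContDiff ℝ ∞ fun p : E n × E n => p.2 i := fun i => by fun_prop
  exact ((contDiff_const.mul (ContDiff.sum fun i _ => (h2 i).mul (contDiff_pd hU _))).add
    (contDiff_const.mul (contDiff_lapV hU))).sub
    (contDiff_const.mul (ContDiff.sum fun i _ => (contDiff_pd hU _).pow 2))

lemma kin_add_hfun {U : E n × E n → ℝ} (hU : ContDiff ℝ ∞ U) (p : E n × E n) :
    kin (fun q => -(1 / 2) * U q) p + hfun U p = 0 := by
  rw [kin, hfun, lapV_const_mul hU]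
  simp only [pd_const_mul hU.diff]
  simp only [mul_pow, mul_left_comm _ (-(1 / 2) : ℝ), ← Finset.mul_sum]
  ring

end Forms

section Potential

variable {n : ℕ} {h : E n × E n → ℝ} {k₁ k₂ : ℝ}

lemma tangent_of_hess (sh : ContDiff ℝ ∞ h)
    (hh : ∀ p, (Hess h p - blockDiag n (-k₁) (-k₂)).PosSemidef) (p z : E n × E n) :
    h p + fderiv ℝ h p z - (k₁ * ‖z.1‖ ^ 2 + k₂ * ‖z.2‖ ^ 2) / 2 ≤ h (p + z) := by
  refine tangent_lower_bound sh p z fun s _ => ?_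
  have h1 := coords_dotProduct_nonneg (hh (p + s • z)) z
  have h2 := coords_dotProduct_fromBlocks (-k₁) 0 0 (-k₂) z
  rw [zero_smul] at h2
  rw [Matrix.sub_mulVec, dotProduct_sub, _root_.blockDiag, h2] at h1
  linarith

lemma midpoint_of_hess (sh : ContDiff ℝ ∞ h)
    (hh : ∀ p, (Hess h p - blockDiag n (-k₁) (-k₂)).PosSemidef) (p z : E n × E n) :
    h p - (k₁ * ‖z.1‖ ^ 2 + k₂ * ‖z.2‖ ^ 2) / 2 ≤ (h (p + z) + h (p + -z)) / 2 := by
  have h1 := tangent_of_hess sh hh p z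
  have h2 := tangent_of_hess sh hh p (-z)
  simp only [map_neg, Prod.fst_neg, Prod.snd_neg, norm_neg] at h2
  linarith

lemma cost_le_nsq (hk₁ : 0 ≤ k₁) (hk₂ : 0 ≤ k₂) (z : E n × E n) :
    (k₁ * ‖z.1‖ ^ 2 + k₂ * ‖z.2‖ ^ 2) / 2 ≤ (k₁ + k₂) * nsq z := by
  have h1 : 0 ≤ k₁ * ‖z.1‖ ^ 2 := by positivity
  have h2 : 0 ≤ k₂ * ‖z.2‖ ^ 2 := by positivity
  have h3 : 0 ≤ k₁ * ‖z.2‖ ^ 2 := by positivity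
  have h4 : 0 ≤ k₂ * ‖z.1‖ ^ 2 := by positivity
  unfold nsq
  linarith

lemma exists_lower_bound_of_hess (hk₁ : 0 ≤ k₁) (hk₂ : 0 ≤ k₂) (sh : ContDiff ℝ ∞ h)
    (hh : ∀ p, (Hess h p - blockDiag n (-k₁) (-k₂)).PosSemidef) :
    ∃ C : ℝ, 0 ≤ C ∧ ∀ p, -(C * (1 + nsq p)) ≤ h p := by
  refine ⟨|h 0| + ‖fderiv ℝ h 0‖ + (k₁ + k₂), by positivity, fun p => ?_⟩
  have h1 := tangent_of_hess sh hh 0 p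
  rw [zero_add] at h1
  have h2 := cost_le_nsq hk₁ hk₂ p
  have h3 := neg_le_of_abs_le ((fderiv ℝ h 0).le_opNorm p)
  have h4 : ‖p‖ ≤ 1 + nsq p := by nlinarith [norm_sq_le_nsq p, sq_nonneg (‖p‖ - 1)]
  have h5 : ‖fderiv ℝ h 0‖ * ‖p‖ ≤ ‖fderiv ℝ h 0‖ * (1 + nsq p) :=
    mul_le_mul_of_nonneg_left h4 (norm_nonneg _)
  have h6 := neg_abs_le (h 0)
  have h7 : 0 ≤ |h 0| * nsq p := mul_nonneg (abs_nonneg _) (nsq_nonneg p)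
  linarith

end Potential

section Growth

variable {n : ℕ}

lemma abs_fderiv_le (φ : E n × E n → ℝ) (p z : E n × E n) :
    fderiv ℝ φ p z ≤ √(nsq z) * √(gradNormSq φ p) := by
  rw [fderiv_apply_eq_sum, ← sum_coords_sq, gradNormSq]
  exact Real.sum_mul_le_sqrt_mul_sqrt _ _ _

lemma le_exp_of_grad_le {φ u : E n × E n → ℝ} (hφ : Differentiable ℝ φ) {a C : ℝ} (ha : 0 ≤ a)
    (hC : 0 ≤ C) (hu : ∀ p, u p ≤ C * (1 + nsq p))
    (hgrad : ∀ p, √(gradNormSq φ p) ≤ a * Real.exp (u p) * (‖p.1‖ + ‖p.2‖)) (p : E n × E n) :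
    φ p ≤ φ 0 + 2 * a * Real.exp ((C + 2) * (1 + nsq p)) := by
  have hd := hasDerivAt_line hφ 0 p
  obtain ⟨s, hs, hslope⟩ := exists_hasDerivAt_eq_slope _ _ one_pos
    (fun s _ => (hd s).continuousAt.continuousWithinAt) (fun s _ => hd s)
  rw [← fderiv_apply_eq_sum] at hslope
  simp only [zero_add, one_smul, zero_smul, sub_zero, div_one] at hslope
  set q := s • p with hq
  have hn := nsq_nonneg p
  have hqp : nsq q ≤ nsq p := by
    rw [hq, nsq_smul]
    exact mul_le_of_le_one_left hn (pow_le_one₀ hs.1.le hs.2.le)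
  set m := 1 + nsq p with hm
  have hnorm : ‖q.1‖ + ‖q.2‖ ≤ 2 * m := by
    have : nsq q = ‖q.1‖ ^ 2 + ‖q.2‖ ^ 2 := rfl
    nlinarith [sq_nonneg (‖q.1‖ - 1), sq_nonneg (‖q.2‖ - 1)]
  have hsqrt : √(nsq p) ≤ m := by
    rw [Real.sqrt_le_left (by linarith)]
    nlinarith
  have hexp : Real.exp (u q) ≤ Real.exp (C * m) :=
    Real.exp_le_exp.2 ((hu q).trans (mul_le_mul_of_nonneg_left (by linarith) hC))
  have hm2 : m * m ≤ Real.exp (2 * m) := by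
    rw [two_mul, Real.exp_add]
    have := Real.add_one_le_exp m
    exact mul_self_le_mul_self (by linarith) (by linarith)
  have h1 : fderiv ℝ φ q p ≤ m * (a * Real.exp (C * m) * (2 * m)) := by
    refine (abs_fderiv_le φ q p).trans (mul_le_mul hsqrt ((hgrad q).trans ?_) (by positivity)
      (by linarith))
    gcongr
  have h2 : 2 * a * Real.exp (C * m) * (m * m) ≤ 2 * a * Real.exp (C * m) * Real.exp (2 * m) :=
    mul_le_mul_of_nonneg_left hm2 (by positivity)
  rw [add_mul, Real.exp_add]
  linarith

end Growth

section SecondDifference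

variable {n : ℕ} {k₁ k₂ : ℝ}

/-- Twice the minimal cost of a path from `0` to `ζ` in time `s`. -/
def pathCost (k₁ k₂ : ℝ) (ζ : E n × E n) (s : ℝ) : ℝ :=
  1 / 2 * (s1C k₁ k₂ s / s0C k₁ k₂ s * ‖ζ.1‖ ^ 2
    - 2 * (s2C k₁ k₂ s / s0C k₁ k₂ s) * inner ℝ ζ.1 ζ.2
    + deriv (s0C k₁ k₂) s / s0C k₁ k₂ s * ‖ζ.2‖ ^ 2)

lemma pathCost_smul (ε : ℝ) (ζ : E n × E n) (s : ℝ) :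
    pathCost k₁ k₂ (ε • ζ) s = ε ^ 2 * pathCost k₁ k₂ ζ s := by
  simp only [pathCost, Prod.smul_fst, Prod.smul_snd, norm_smul, mul_pow, Real.norm_eq_abs, sq_abs,
    real_inner_smul_left, real_inner_smul_right]
  ring

lemma continuousAt_pathCost (ζ : E n × E n) {s : ℝ} (hs : s0C k₁ k₂ s ≠ 0) :
    ContinuousAt (pathCost k₁ k₂ ζ) s := by
  have h0 : ContinuousAt (s0C k₁ k₂) s := (hasDerivAt_s0C k₁ k₂ s).continuousAt
  have h1 : ContinuousAt (s1C k₁ k₂) s := by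
    unfold s1C
    fun_prop
  have h2 : ContinuousAt (s2C k₁ k₂) s := by
    unfold s2C
    fun_prop
  have h3 : ContinuousAt (deriv (s0C k₁ k₂)) s := by
    rw [funext fun s => (hasDerivAt_s0C k₁ k₂ s).deriv]
    fun_prop
  exact continuousAt_const.mul ((((h1.div h0 hs).mul continuousAt_const).sub
    ((continuousAt_const.mul (h2.div h0 hs)).mul continuousAt_const)).add
    ((h3.div h0 hs).mul continuousAt_const))

lemma coords_dotProduct_harnackMatrix (ζ : E n × E n) (t : ℝ) :
    coords ζ ⬝ᵥ (harnackMatrix n (s0C k₁ k₂) (s1C k₁ k₂) (s2C k₁ k₂) t *ᵥ coords ζ)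
      = -pathCost k₁ k₂ ζ t := by
  rw [harnackMatrix, Matrix.smul_mulVec, dotProduct_smul, coords_dotProduct_fromBlocks, pathCost,
    smul_eq_mul]
  ring

lemma hess_add_nonneg_of_midpoint {φ : E n × E n → ℝ} (hφ : ContDiff ℝ ∞ φ) (p ζ : E n × E n)
    {K : ℝ} (hmid : ∀ ε : ℝ,
      φ p ≤ 1 / 2 * (φ (p + ε • ζ) + φ (p + -(ε • ζ))) + ε ^ 2 * K / 2) :
    0 ≤ coords ζ ⬝ᵥ (Hess φ p *ᵥ coords ζ) + K := by
  have h1 := fun s => ((((hasDerivAt_line hφ.diff p ζ s).add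
    (hasDerivAt_line hφ.diff p (-ζ) s)).const_mul (1 / 2)).add
    (((hasDerivAt_pow 2 s).mul_const K).div_const 2))
  have h2 := ((((hasDerivAt_line_pd hφ p ζ 0).add
    (hasDerivAt_line_pd hφ p (-ζ) 0)).const_mul (1 / 2)).add
    ((((hasDerivAt_id (0 : ℝ)).const_mul 2).mul_const K).div_const 2))
  have h3 := (second_deriv_nonneg_of_min h1 (h2.congr_of_eventuallyEq
    (Filter.Eventually.of_forall fun s => by simp)) fun s => by
      have := hmid s
      simp only [zero_smul, add_zero, neg_zero, smul_neg, Pi.add_apply]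
      linarith).2
  simp only [coords_neg, zero_smul, add_zero, Matrix.mulVec_neg, dotProduct_neg, neg_dotProduct,
    neg_neg] at h3
  linarith

lemma contDiff_slice {T : ℝ} {f : ℝ → E n × E n → ℝ}
    (hf : ContDiffOn ℝ ∞ (fun q : ℝ × (E n × E n) => f q.1 q.2) (Ioo 0 T ×ˢ univ))
    {t : ℝ} (ht : t ∈ Ioo 0 T) : ContDiff ℝ ∞ (f t) :=
  contDiffOn_univ.1 <| hf.comp (s := univ) (contDiff_const.prodMk contDiff_id).contDiffOn
    fun _ _ => ⟨ht, mem_univ _⟩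

lemma hess_add_pathCost_nonneg {h : E n × E n → ℝ} {ℓ : ℝ → E n × E n → ℝ} {T C : ℝ}
    (hk₁ : 0 ≤ k₁) (hk₂ : 0 ≤ k₂) (hk : k₂ ^ 2 < 2 * k₁)
    (hC : 0 ≤ C) (hup : ∀ p, h p ≤ C * (1 + nsq p))
    (hℓ : ContDiffOn ℝ ∞ (fun q : ℝ × (E n × E n) => ℓ q.1 q.2) (Ioo 0 T ×ˢ univ))
    (eℓ : ∀ t ∈ Ioo 0 T, ∀ p, deriv (fun τ => ℓ τ p) t = kin (ℓ t) p + h p)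
    (hgrow : ∀ t₀ t₁, 0 < t₀ → t₁ < T →
      ∃ A : ℝ, 0 ≤ A ∧ ∀ t ∈ Icc t₀ t₁, ∀ p, ℓ t p ≤ A * (1 + nsq p))
    (hmid : ∀ p z, h p - (k₁ * ‖z.1‖ ^ 2 + k₂ * ‖z.2‖ ^ 2) / 2 ≤ (h (p + z) + h (p + -z)) / 2)
    {t : ℝ} (ht : t ∈ Ioo 0 T) (hs : s0C k₁ k₂ t ≠ 0) (p ζ : E n × E n) :
    0 ≤ coords ζ ⬝ᵥ (Hess (ℓ t) p *ᵥ coords ζ) + pathCost k₁ k₂ ζ t := by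
  have hlt : ∀ t₀ ∈ Ioo 0 t, s0C k₁ k₂ (t - t₀) ≠ 0 →
      0 ≤ coords ζ ⬝ᵥ (Hess (ℓ t) p *ᵥ coords ζ) + pathCost k₁ k₂ ζ (t - t₀) := by
    intro t₀ ht₀ hs₀
    refine hess_add_nonneg_of_midpoint (contDiff_slice hℓ ht) p ζ fun ε => ?_
    obtain ⟨A, hA, hAgrow⟩ := hgrow t₀ t ht₀.1 ht.2
    obtain ⟨z, w, c, hz, hz0, hzs, hc, hc0, hcs⟩ := exists_path hk₁ hk₂ hk hs₀ (ε • ζ)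
    have := midpoint_inequality ht₀.1 ht₀.2.le ht.2 hA hC hup hℓ eℓ hAgrow hmid
      (fun τ => (hz (τ - t₀)).comp_sub_const τ t₀) (by simpa using hz0)
      (fun τ => (hc (τ - t₀)).comp_sub_const τ t₀) (by simpa using hc0) p
    simp only [hzs] at this
    have h2 : 2 * c (t - t₀) = ε ^ 2 * pathCost k₁ k₂ ζ (t - t₀) := by
      rw [← pathCost_smul, hcs, pathCost]
    linarith
  have hsub : Filter.Tendsto (fun t₀ => t - t₀) (nhdsWithin 0 (Ioi 0)) (nhds t) := by
    have : ContinuousAt (fun t₀ : ℝ => t - t₀) 0 := by fun_prop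
    simpa using this.tendsto.mono_left nhdsWithin_le_nhds
  refine ge_of_tendsto (((continuousAt_pathCost ζ hs).tendsto.comp hsub).const_add _) ?_
  filter_upwards [Ioo_mem_nhdsGT ht.1,
    hsub.eventually ((hasDerivAt_s0C k₁ k₂ t).continuousAt.eventually_ne hs)] with t₀ h1 h2
  exact hlt t₀ h1 h2

end SecondDifference

section LogDensity

variable {n : ℕ} {T : ℝ} {U : E n × E n → ℝ} {ρ : ℝ → E n × E n → ℝ}

lemma differentiableAt_time {f : ℝ → E n × E n → ℝ}
    (hf : ContDiffOn ℝ ∞ (fun q : ℝ × (E n × E n) => f q.1 q.2) (Ioo 0 T ×ˢ univ))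
    {t : ℝ} (ht : t ∈ Ioo 0 T) (p : E n × E n) : DifferentiableAt ℝ (fun τ => f τ p) t := by
  have h1 : ContDiffAt ℝ ∞ (fun q : ℝ × (E n × E n) => f q.1 q.2) (t, p) :=
    hf.contDiffAt ((isOpen_Ioo.prod isOpen_univ).mem_nhds ⟨ht, mem_univ _⟩)
  exact (h1.differentiableAt (by simp)).comp t
    (f := fun τ => (τ, p)) (differentiableAt_id.prodMk (differentiableAt_const p))

lemma contDiffOn_log_add (hU : ContDiff ℝ ∞ U)
    (hρ : ContDiffOn ℝ ∞ (fun q : ℝ × (E n × E n) => ρ q.1 q.2) (Ioo 0 T ×ˢ univ))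
    (hpos : ∀ t ∈ Ioo 0 T, ∀ p, 0 < ρ t p) :
    ContDiffOn ℝ ∞ (fun q : ℝ × (E n × E n) => Real.log (ρ q.1 q.2) + -(1 / 2) * U q.2)
      (Ioo 0 T ×ˢ univ) :=
  (hρ.log fun q hq => (hpos q.1 hq.1 q.2).ne').add
    (contDiff_const.mul (hU.comp contDiff_snd)).contDiffOn

lemma deriv_log_add (hU : ContDiff ℝ ∞ U)
    (hρ : ContDiffOn ℝ ∞ (fun q : ℝ × (E n × E n) => ρ q.1 q.2) (Ioo 0 T ×ˢ univ))
    (hpos : ∀ t ∈ Ioo 0 T, ∀ p, 0 < ρ t p)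
    (hpde : ∀ t ∈ Ioo 0 T, ∀ p : E n × E n,
      deriv (fun τ => ρ τ p) t =
        lapV (ρ t) p - (∑ i : Fin n, pd U (Sum.inr i) p * pd (ρ t) (Sum.inr i) p)
          - ∑ i : Fin n, p.2 i * pd (ρ t) (Sum.inl i) p)
    {t : ℝ} (ht : t ∈ Ioo 0 T) (p : E n × E n) :
    deriv (fun τ => Real.log (ρ τ p) + -(1 / 2) * U p) t
      = kin (fun q => Real.log (ρ t q) + -(1 / 2) * U q) p + hfun U p := by
  have hlog : ContDiff ℝ ∞ fun q => Real.log (ρ t q) :=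
    (contDiff_slice hρ ht).log fun q => (hpos t ht q).ne'
  have hu : ContDiff ℝ ∞ fun q => -(1 / 2) * U q := contDiff_const.mul hU
  have hexp : ρ t = fun q => Real.exp (Real.log (ρ t q)) :=
    funext fun q => (Real.exp_log (hpos t ht q)).symm
  have h1 := hpde t ht p
  rw [hexp, lapV_exp hlog] at h1
  simp only [pd_exp hlog.diff, Real.exp_log (hpos t ht p)] at h1
  rw [deriv_add_const, deriv.log (differentiableAt_time hρ ht p) (hpos t ht p).ne', h1,
    div_eq_iff (hpos t ht p).ne']
  have h2 : hfun U p = -kin (fun q => -(1 / 2) * U q) p := by linarith [kin_add_hfun hU p]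
  rw [h2, kin, kin, lapV_add hlog hu]
  simp only [pd_add hlog.diff hu.diff, pd_const_mul hU.diff]
  have h3 : ∀ a b : Fin n → ℝ, (∑ i, (a i + -(1 / 2) * b i) ^ 2)
      = (∑ i, a i ^ 2) - (∑ i, b i * a i) + ∑ i, (-(1 / 2) * b i) ^ 2 := fun a b => by
    rw [← Finset.sum_sub_distrib, ← Finset.sum_add_distrib]
    exact Finset.sum_congr rfl fun i _ => by ring
  have h4 : ∀ a b : Fin n → ℝ, ∑ i, b i * (ρ t p * a i) = ρ t p * ∑ i, b i * a i := fun a b => by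
    rw [Finset.mul_sum]
    exact Finset.sum_congr rfl fun i _ => by ring
  rw [h4 (fun i => pd (fun q => Real.log (ρ t q)) (Sum.inr i) p),
    h4 (fun i => pd (fun q => Real.log (ρ t q)) (Sum.inl i) p),
    h3 (fun i => pd (fun q => Real.log (ρ t q)) (Sum.inr i) p) fun i => pd U (Sum.inr i) p]
  simp only [mul_add, Finset.sum_add_distrib]
  ring

lemma exists_log_add_le {a₀ C : ℝ} (ha₀ : 0 ≤ a₀) (hC : 0 ≤ C)
    (hu : ∀ p, |-(1 / 2) * U p| ≤ C * (1 + nsq p))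
    (hρ : ContDiffOn ℝ ∞ (fun q : ℝ × (E n × E n) => ρ q.1 q.2) (Ioo 0 T ×ˢ univ))
    (hpos : ∀ t ∈ Ioo 0 T, ∀ p, 0 < ρ t p)
    (hgrad : ∀ t ∈ Ioo 0 T, ∀ p : E n × E n,
      √(gradNormSq (ρ t) p) ≤ a₀ * Real.exp (-U p / 2) * (‖p.1‖ + ‖p.2‖))
    {t₀ t₁ : ℝ} (h0 : 0 < t₀) (h1 : t₁ < T) :
    ∃ A : ℝ, 0 ≤ A ∧ ∀ t ∈ Icc t₀ t₁, ∀ p,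
      Real.log (ρ t p) + -(1 / 2) * U p ≤ A * (1 + nsq p) := by
  have hsub : Icc t₀ t₁ ⊆ Ioo 0 T := fun t ht => ⟨h0.trans_le ht.1, ht.2.trans_lt h1⟩
  have hcont : ContinuousOn (fun t => ρ t 0) (Icc t₀ t₁) := fun t ht =>
    (differentiableAt_time hρ (hsub ht) 0).continuousAt.continuousWithinAt
  obtain ⟨R, hR⟩ := isCompact_Icc.bddAbove_image hcont
  set M := |R| + 2 * a₀ + 1 with hM
  have hM1 : 1 ≤ M := by linarith [abs_nonneg R]
  have hlogM := Real.log_nonneg hM1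
  refine ⟨Real.log M + (C + 2) + C, by positivity, fun t ht p => ?_⟩
  have hn := nsq_nonneg p
  have hgrad' : ∀ q : E n × E n, √(gradNormSq (ρ t) q)
      ≤ a₀ * Real.exp (-(1 / 2) * U q) * (‖q.1‖ + ‖q.2‖) := fun q => by
    have := hgrad t (hsub ht) q
    rwa [show -U q / 2 = -(1 / 2) * U q by ring] at this
  have h2 := le_exp_of_grad_le (contDiff_slice hρ (hsub ht)).diff ha₀ hC
    (fun q => (le_abs_self _).trans (hu q)) hgrad' p
  have h3 : ρ t 0 ≤ |R| := (hR (mem_image_of_mem _ ht)).trans (le_abs_self R)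
  have h4 : 1 ≤ Real.exp ((C + 2) * (1 + nsq p)) := Real.one_le_exp (by positivity)
  have h5 : ρ t p ≤ M * Real.exp ((C + 2) * (1 + nsq p)) := by
    have := mul_le_mul_of_nonneg_left h4 (abs_nonneg R)
    rw [hM, add_mul, add_mul]
    linarith
  have h6 := Real.log_le_log (hpos t (hsub ht) p) h5
  rw [Real.log_mul (by linarith) (Real.exp_pos _).ne', Real.log_exp] at h6
  have h7 := (le_abs_self _).trans (hu p)
  have h8 : 0 ≤ Real.log M * nsq p := mul_nonneg hlogM hn
  linarith

end LogDensity

/-- **Matrix differential Harnack inequality, case `k₂² < 2k₁`** (Theorem 2.1 (3)). -/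
theorem matrix_harnack_case3
    (n : ℕ) (hn : 1 ≤ n) (T : ℝ) (hT : 0 < T)
    (U : E n × E n → ℝ) (hU : ContDiff ℝ (⊤ : ℕ∞) U)
    (ρ : ℝ → E n × E n → ℝ)
    (hρ : ContDiffOn ℝ (⊤ : ℕ∞) (fun q : ℝ × (E n × E n) => ρ q.1 q.2) (Ioo 0 T ×ˢ univ))
    (hpos : ∀ t ∈ Ioo 0 T, ∀ p : E n × E n, 0 < ρ t p)
    (hpde : ∀ t ∈ Ioo 0 T, ∀ p : E n × E n,
      deriv (fun τ => ρ τ p) t =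
        lapV (ρ t) p - (∑ i : Fin n, pd U (Sum.inr i) p * pd (ρ t) (Sum.inr i) p)
          - ∑ i : Fin n, p.2 i * pd (ρ t) (Sum.inl i) p)
    (a₀ a₁ : ℝ) (ha₀ : 0 < a₀) (ha₁ : 0 < a₁)
    (hgrow1 : ∀ t ∈ Ioo 0 T, ∀ p : E n × E n,
      Real.sqrt (gradNormSq (ρ t) p) ≤ a₀ * Real.exp (-U p / 2) * (‖p.1‖ + ‖p.2‖))
    (hgrow2 : ∀ t ∈ Ioo 0 T, ∀ p : E n × E n,
      (Hess (ρ t) p + (a₀ * Real.exp (a₁ * (‖p.1‖ ^ 2 + ‖p.2‖ ^ 2))) •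
        (1 : Matrix (Fin n ⊕ Fin n) (Fin n ⊕ Fin n) ℝ)).PosSemidef)
    (hgrow3 : ∀ p : E n × E n,
      ((a₀ * Real.exp (a₁ * (‖p.1‖ ^ 2 + ‖p.2‖ ^ 2))) •
        (1 : Matrix (Fin n ⊕ Fin n) (Fin n ⊕ Fin n) ℝ) - Hess U p).PosSemidef)
    (k₁ k₂ : ℝ) (hk₁ : 0 ≤ k₁) (hk₂ : 0 ≤ k₂) (hk : k₂ ^ 2 < 2 * k₁)
    (hh : ∀ p : E n × E n, (Hess (hfun U) p - blockDiag n (-k₁) (-k₂)).PosSemidef) :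
    ∀ t ∈ Ioo 0 T, 0 < s0C k₁ k₂ t → ∀ p : E n × E n,
      (Hess (fun q => Real.log (ρ t q)) p - (1/2 : ℝ) • Hess U p
        - harnackMatrix n (s0C k₁ k₂) (s1C k₁ k₂) (s2C k₁ k₂) t).PosSemidef := by
  have sh := contDiff_hfun hU
  have su : ContDiff ℝ ∞ fun q => -(1 / 2) * U q := contDiff_const.mul hU
  obtain ⟨C₀, hC₀, hlow⟩ := exists_lower_bound_of_hess hk₁ hk₂ sh hh
  have hess : ∀ p z : E n × E n, -(a₀ / 2 * Real.exp (a₁ * nsq p) * nsq z)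
      ≤ coords z ⬝ᵥ (Hess (fun q => -(1 / 2) * U q) p *ᵥ coords z) := fun p z => by
    have h1 := coords_dotProduct_nonneg (hgrow3 p) z
    rw [Matrix.sub_mulVec, dotProduct_sub, Matrix.smul_mulVec, Matrix.one_mulVec, dotProduct_smul,
      coords_dotProduct_self, smul_eq_mul] at h1
    rw [hess_const_mul hU, Matrix.smul_mulVec, dotProduct_smul, smul_eq_mul, nsq]
    linarith
  obtain ⟨C, hC, hu⟩ := exists_abs_le su (kin_add_hfun hU) hC₀ hlow (by positivity) ha₁.le hess
  obtain ⟨C', hC', hup⟩ := exists_le_of_semiconvex su (kin_add_hfun hU) hC (add_nonneg hk₁ hk₂) hu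
    fun p z => (sub_le_sub_left (cost_le_nsq hk₁ hk₂ z) _).trans (tangent_of_hess sh hh p z)
  have sℓ := contDiffOn_log_add hU hρ hpos
  intro t ht hs p
  have slog : ContDiff ℝ ∞ fun q => Real.log (ρ t q) :=
    (contDiff_slice hρ ht).log fun q => (hpos t ht q).ne'
  refine posSemidef_of_coords (((hess_isHermitian slog p).sub ?_).sub ?_) fun ζ => ?_
  · exact (hess_isHermitian hU p).smul (by simp)
  · refine Matrix.IsHermitian.smul (Matrix.IsHermitian.fromBlocks ?_ ?_ ?_) (by simp)
    all_goals simp [Matrix.IsHermitian]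
  · have := hess_add_pathCost_nonneg (ℓ := fun t q => Real.log (ρ t q) + -(1 / 2) * U q)
      hk₁ hk₂ hk hC' hup sℓ
      (fun t ht p => deriv_log_add hU hρ hpos hpde ht p)
      (fun t₀ t₁ h0 h1 => exists_log_add_le ha₀.le hC hu hρ hpos hgrow1 h0 h1)
      (midpoint_of_hess sh hh) ht hs.ne' p ζ
    rw [hess_add slog su, hess_const_mul hU, Matrix.add_mulVec, dotProduct_add, Matrix.smul_mulVec,
      dotProduct_smul, smul_eq_mul] at this
    rw [Matrix.sub_mulVec, Matrix.sub_mulVec, dotProduct_sub, dotProduct_sub,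
      coords_dotProduct_harnackMatrix, Matrix.smul_mulVec, dotProduct_smul, smul_eq_mul]
    linarith
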